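/- arXiv:1105.2501 — 4 statements merged into one kernel-verified Lean document; each statement's English description precedes it below -/
import Mathlib

section
/- Let k be a positive integer, let γ ∈ (0,1), and let λ_1, …, λ_k ∈ [0,1]. Then the number of indices j with λ_j > γ satisfies card{j : λ_j > γ} ≥ Σ_{j=1}^k λ_j − (1−γ)^{-1} Σ_{j=1}^k λ_j (1−λ_j). -/
/-- **Eigenvalue counting inequality (lower bound).**
For `k ≥ 1`, `γ ∈ (0,1)` and `λ₁, …, λ_k ∈ [0,1]`, the number of indices `j` with
`λ_j > γ` is at least `Σ λ_j − (1−γ)⁻¹ Σ λ_j (1−λ_j)`. -/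
theorem stmt_0 (k : ℕ) (hk : 0 < k) (γ : ℝ) (hγ : γ ∈ Set.Ioo (0:ℝ) 1)
    (lam : Fin k → ℝ) (hlam : ∀ j, lam j ∈ Set.Icc (0:ℝ) 1) :
    (∑ j, lam j) - (1 - γ)⁻¹ * ∑ j, lam j * (1 - lam j) ≤
      ((Finset.univ.filter fun j => γ < lam j).card : ℝ) := by
  rw [Finset.mul_sum, ← Finset.sum_sub_distrib, Finset.card_filter, Nat.cast_sum]
  refine Finset.sum_le_sum fun j _ => ?_
  obtain ⟨h0, h1⟩ := hlam j
  have hpos : 0 < 1 - γ := sub_pos.mpr hγ.2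
  split_ifs with h
  · have : 0 ≤ (1 - γ)⁻¹ * (lam j * (1 - lam j)) :=
      mul_nonneg (inv_nonneg.mpr hpos.le) (mul_nonneg h0 (sub_nonneg.mpr h1))
    push_cast
    linarith
  · have : lam j ≤ (1 - γ)⁻¹ * (lam j * (1 - lam j)) := by
      rw [le_inv_mul_iff₀ hpos, mul_comm (1 - γ)]
      exact mul_le_mul_of_nonneg_left (by linarith) h0
    push_cast
    linarith
end

section
/- Let m ≥ 1 and let N be a natural number with N + 1 > m. There exists a constant C = C(m, N) such that for every L > 0, every R ≥ 2, every finite family of points {z_j}_{j ∈ J} in ℝ^m with |z_j − z_l| ≥ R/L for all j ≠ l, and every k ∈ J, one has Σ_{j ∈ J, j ≠ k} (1 + L|z_j − z_k|)^{-(N+1)} ≤ C (R − 1)^{m − (N+1)}. -/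
open Metric

open MeasureTheory in
/-- The function `(1 + ‖x‖) ^ (-r)`, with `r` larger than the dimension, is summable over
`1`-separated families, uniformly in the family. -/
lemma exists_sum_one_add_norm_rpow_neg_le {E : Type*} [NormedAddCommGroup E] [NormedSpace ℝ E]
    [FiniteDimensional ℝ E] [MeasurableSpace E] [BorelSpace E] (μ : Measure E)
    [μ.IsAddHaarMeasure] {r : ℝ} (hr : (Module.finrank ℝ E : ℝ) < r) :
    ∃ K : ℝ, 0 < K ∧ ∀ {ι : Type*} (J : Finset ι) (w : ι → E),
      (∀ j ∈ J, ∀ l ∈ J, j ≠ l → 1 ≤ dist (w j) (w l)) →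
      ∑ j ∈ J, (1 + ‖w j‖) ^ (-r) ≤ K := by
  have hint : Integrable (fun x : E => (1 + ‖x‖) ^ (-r)) μ := integrable_one_add_norm hr
  have hr0 : 0 ≤ r := (Nat.cast_nonneg _).trans hr.le
  set V := μ.real (ball (0 : E) (1 / 2)) with hV
  have hVpos : 0 < V :=
    ENNReal.toReal_pos (measure_ball_pos μ 0 (by norm_num)).ne' measure_ball_lt_top.ne
  set I := ∫ x, (1 + ‖x‖) ^ (-r) ∂μ with hI
  have hI0 : 0 ≤ I := integral_nonneg fun x => by positivity
  refine ⟨I / (2 ^ (-r) * V) + 1, by positivity, fun {ι} J w hw => ?_⟩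
  have hball : ∀ j, 2 ^ (-r) * V * (1 + ‖w j‖) ^ (-r)
      ≤ ∫ x in ball (w j) (1 / 2), (1 + ‖x‖) ^ (-r) ∂μ := by
    intro j
    have hle : ∀ x ∈ ball (w j) (1 / 2), (2 * (1 + ‖w j‖)) ^ (-r) ≤ (1 + ‖x‖) ^ (-r) := by
      intro x hx
      refine Real.rpow_le_rpow_of_nonpos (by positivity) ?_ (by linarith)
      have h1 := norm_le_norm_add_norm_sub' x (w j)
      rw [mem_ball, dist_eq_norm] at hx
      linarith [norm_nonneg (w j)]
    have h := setIntegral_ge_of_const_le_real measurableSet_ball measure_ball_lt_top.ne hle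
      hint.integrableOn
    rw [Real.mul_rpow (by norm_num) (by positivity), Measure.real, μ.addHaar_ball_center] at h
    rw [hV, Measure.real]
    linarith
  have hdisj : (J : Set ι).Pairwise (Function.onFun Disjoint fun j => ball (w j) (1 / 2)) := by
    intro j hj l hl hjl
    exact ball_disjoint_ball (by linarith [hw j hj l hl hjl])
  have hsum : 2 ^ (-r) * V * ∑ j ∈ J, (1 + ‖w j‖) ^ (-r) ≤ I := by
    rw [Finset.mul_sum]
    refine (Finset.sum_le_sum fun j _ => hball j).trans ?_
    rw [← integral_biUnion_finset J (fun _ _ => measurableSet_ball) hdisj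
      (fun _ _ => hint.integrableOn)]
    exact setIntegral_le_integral hint (Filter.Eventually.of_forall fun x => by positivity)
  have := (le_div_iff₀' (by positivity)).2 hsum
  linarith

/-- **Off-diagonal summability for separated points.**
For `m ≥ 1` and `N + 1 > m` there is a constant `C = C(m, N)` such that for every
`L > 0`, every `R ≥ 2`, every finite family of points in `ℝ^m` pairwise separated by
`R/L`, and every point `z_k` of the family,
`Σ_{j ≠ k} (1 + L|z_j − z_k|)^{-(N+1)} ≤ C (R−1)^{m−(N+1)}`. -/
theorem stmt_6 (m N : ℕ) (hm : 1 ≤ m) (hmN : m < N + 1) :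
    ∃ C : ℝ, 0 < C ∧ ∀ (L R : ℝ), 0 < L → 2 ≤ R →
      ∀ (ι : Type) (_ : DecidableEq ι) (J : Finset ι)
        (z : ι → EuclideanSpace ℝ (Fin m)),
        (∀ j ∈ J, ∀ l ∈ J, j ≠ l → R / L ≤ dist (z j) (z l)) →
        ∀ k ∈ J, ∑ j ∈ J.erase k, ((1 + L * dist (z j) (z k)) ^ (N + 1))⁻¹ ≤
          C * (R - 1) ^ ((m : ℝ) - ((N : ℝ) + 1)) := by
  obtain ⟨K, hK, hsum⟩ := exists_sum_one_add_norm_rpow_neg_le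
    (MeasureTheory.volume : MeasureTheory.Measure (EuclideanSpace ℝ (Fin m)))
    (r := ((N + 1 : ℕ) : ℝ)) (by rw [finrank_euclideanSpace_fin]; exact_mod_cast hmN)
  refine ⟨2 ^ (N + 1) * K, by positivity, fun L R hL hR ι _ J z hz k hk => ?_⟩
  have hR0 : 0 < R := by linarith
  set w : ι → EuclideanSpace ℝ (Fin m) := fun j => (L / R) • (z j - z k) with hw
  have hdist : ∀ j l, dist (w j) (w l) = L / R * dist (z j) (z l) := by
    intro j l
    simp only [hw]
    rw [dist_smul₀, dist_sub_right, Real.norm_of_nonneg (by positivity)]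
  have hnorm : ∀ j, ‖w j‖ = L / R * dist (z j) (z k) := by
    intro j
    rw [← hdist, ← dist_zero_right]
    simp [hw]
  have hsep : ∀ j ∈ J, ∀ l ∈ J, j ≠ l → 1 ≤ L / R * dist (z j) (z l) := by
    intro j hj l hl hjl
    calc (1 : ℝ) = L / R * (R / L) := by field_simp
      _ ≤ _ := by gcongr; exact hz j hj l hl hjl
  have hterm : ∀ j ∈ J.erase k, ((1 + L * dist (z j) (z k)) ^ (N + 1))⁻¹ ≤
      2 ^ (N + 1) * (R ^ (N + 1))⁻¹ * (1 + ‖w j‖) ^ (-((N + 1 : ℕ) : ℝ)) := by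
    intro j hj
    obtain ⟨hjk, hjJ⟩ := Finset.mem_erase.1 hj
    have h1 : 1 ≤ ‖w j‖ := hnorm j ▸ hsep j hjJ k hk hjk
    have h2 : L * dist (z j) (z k) = R * ‖w j‖ := by rw [hnorm]; field_simp
    rw [Real.rpow_neg (by positivity), Real.rpow_natCast, h2]
    calc ((1 + R * ‖w j‖) ^ (N + 1))⁻¹ ≤ ((R / 2 * (1 + ‖w j‖)) ^ (N + 1))⁻¹ := by
          gcongr
          nlinarith
      _ = _ := by rw [mul_pow, div_pow]; field_simp
  have hpow : (R ^ (N + 1))⁻¹ ≤ (R - 1) ^ ((m : ℝ) - ((N : ℝ) + 1)) := by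
    calc (R ^ (N + 1))⁻¹ ≤ ((R - 1) ^ (N + 1))⁻¹ := by
          have : 0 < R - 1 := by linarith
          gcongr
          linarith
      _ = (R - 1) ^ (-((N : ℝ) + 1)) := by
          rw [Real.rpow_neg (by linarith), ← Nat.cast_add_one, Real.rpow_natCast]
      _ ≤ _ := Real.rpow_le_rpow_of_exponent_le (by linarith)
          (by linarith [Nat.cast_nonneg (α := ℝ) m])
  calc _ ≤ ∑ j ∈ J.erase k,
        2 ^ (N + 1) * (R ^ (N + 1))⁻¹ * (1 + ‖w j‖) ^ (-((N + 1 : ℕ) : ℝ)) :=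
        Finset.sum_le_sum hterm
    _ ≤ 2 ^ (N + 1) * (R ^ (N + 1))⁻¹ * K := by
        rw [← Finset.mul_sum]
        gcongr
        refine hsum (J.erase k) w fun j hj l hl hjl => ?_
        rw [hdist]
        exact hsep j (Finset.mem_of_mem_erase hj) l (Finset.mem_of_mem_erase hl) hjl
    _ = 2 ^ (N + 1) * K * (R ^ (N + 1))⁻¹ := by ring
    _ ≤ _ := by gcongr
end

section
/- Let (X, d) be a compact metric space and let σ be a Borel probability measure on X such that σ(B(z, r)) > 0 for every z ∈ X and r > 0, and such that sup_{z, w ∈ X} |σ(B(w, r)) / σ(B(z, r)) − 1| → 0 as r → 0⁺. Let (μ_n) be a sequence of Borel probability measures on X and let (r_n) be a sequence of positive reals with r_n → 0 such that sup_{z ∈ X} |μ_n(B(z, r_n)) / σ(B(z, r_n)) − 1| → 0 as n → ∞. Then μ_n converges to σ in the weak-* topology: for every continuous function f : X → ℝ, ∫_X f dμ_n → ∫_X f dσ. -/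
open MeasureTheory Metric Filter

section BallAveraging

variable {X : Type*} [MetricSpace X] [CompactSpace X] [MeasurableSpace X] [BorelSpace X]

theorem measurable_measureReal_ball (μ : Measure X) [IsProbabilityMeasure μ] (r : ℝ) :
    Measurable fun z => μ.real (ball z r) := by
  have hK : MeasurableSet {p : X × X | dist p.2 p.1 < r} :=
    (isOpen_lt (by fun_prop) continuous_const).measurableSet
  exact (measurable_measure_prodMk_left (ν := μ) hK).ennreal_toReal

theorem integral_prod_indicator_dist_fst (μ ν : Measure X) [IsProbabilityMeasure μ]
    [IsProbabilityMeasure ν] (r : ℝ) {f : X → ℝ} (hf : Continuous f) :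
    Integrable ({p : X × X | dist p.1 p.2 < r}.indicator fun p => f p.1) (μ.prod ν) ∧
    ∫ p, {p : X × X | dist p.1 p.2 < r}.indicator (fun p => f p.1) p ∂(μ.prod ν) =
      ∫ z, ν.real (ball z r) * f z ∂μ := by
  have hK : MeasurableSet {p : X × X | dist p.1 p.2 < r} :=
    (isOpen_lt (by fun_prop) continuous_const).measurableSet
  have hint : Integrable (fun p : X × X => f p.1) (μ.prod ν) :=
    (hf.comp continuous_fst).integrable_of_hasCompactSupport (.of_compactSpace _)
  refine ⟨hint.indicator hK, ?_⟩
  rw [integral_prod _ (hint.indicator hK)]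
  congr 1 with z
  have : (fun w => {p : X × X | dist p.1 p.2 < r}.indicator (fun p => f p.1) (z, w)) =
      (ball z r).indicator fun _ => f z := by
    ext w
    simp [Set.indicator, dist_comm]
  rw [this, integral_indicator_const _ measurableSet_ball, smul_eq_mul]

theorem integral_prod_indicator_dist_snd (μ ν : Measure X) [IsProbabilityMeasure μ]
    [IsProbabilityMeasure ν] (r : ℝ) {f : X → ℝ} (hf : Continuous f) :
    Integrable ({p : X × X | dist p.1 p.2 < r}.indicator fun p => f p.2) (μ.prod ν) ∧
    ∫ p, {p : X × X | dist p.1 p.2 < r}.indicator (fun p => f p.2) p ∂(μ.prod ν) =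
      ∫ z, μ.real (ball z r) * f z ∂ν := by
  obtain ⟨h₁, h₂⟩ := integral_prod_indicator_dist_fst ν μ r hf
  have : ({p : X × X | dist p.1 p.2 < r}.indicator fun p => f p.2) =
      ({p : X × X | dist p.1 p.2 < r}.indicator fun p => f p.1) ∘ Prod.swap := by
    ext p
    simp [Set.indicator, dist_comm]
  rw [this]
  refine ⟨h₁.swap, ?_⟩
  rw [← h₂]
  exact integral_prod_swap _

/-- Replacing a nearly constant weight `g` by the constant `v` changes the integral little. -/
theorem abs_integral_mul_sub_le (μ : Measure X) [IsProbabilityMeasure μ] {f g : X → ℝ}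
    (hf : Continuous f) (hg : Measurable g) {C v η : ℝ} (hC : ∀ x, |f x| ≤ C)
    (hgv : ∀ x, |g x - v| ≤ η * v) :
    |∫ x, g x * f x ∂μ - v * ∫ x, f x ∂μ| ≤ η * v * C := by
  have hfi : Integrable f μ := hf.integrable_of_hasCompactSupport (.of_compactSpace _)
  have hgf : Integrable (fun x => (g x - v) * f x) μ :=
    hfi.bdd_mul (hg.sub_const v).aestronglyMeasurable (ae_of_all _ hgv)
  have heq : ∫ x, g x * f x ∂μ - v * ∫ x, f x ∂μ = ∫ x, (g x - v) * f x ∂μ := by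
    have : (fun x => g x * f x) = fun x => (g x - v) * f x + v * f x := by
      ext x; ring
    rw [this, integral_add hgf (hfi.const_mul v), integral_const_mul]
    ring
  rw [heq]
  have := norm_integral_le_of_norm_le_const (μ := μ) (f := fun x => (g x - v) * f x)
    (C := η * v * C) (ae_of_all _ fun x => by
      rw [Real.norm_eq_abs, abs_mul]
      exact mul_le_mul (hgv x) (hC x) (abs_nonneg _) ((abs_nonneg _).trans (hgv x)))
  simpa using this

/-- Two probability measures giving nearly the same mass `v` to all balls of radius `r`
integrate a function of small oscillation at scale `r` to nearly the same value. -/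
theorem abs_integral_sub_integral_le (σ μ : Measure X) [IsProbabilityMeasure σ]
    [IsProbabilityMeasure μ] {f : X → ℝ} (hf : Continuous f) {r v η C ω : ℝ} (hv : 0 < v)
    (hσ : ∀ z, |σ.real (ball z r) - v| ≤ η * v) (hμ : ∀ z, |μ.real (ball z r) - v| ≤ η * v)
    (hC : ∀ x, |f x| ≤ C) (hω₀ : 0 ≤ ω) (hω : ∀ x y, dist x y < r → |f x - f y| ≤ ω) :
    |∫ x, f x ∂μ - ∫ x, f x ∂σ| ≤ 2 * η * C + ω * (1 + η) := by
  obtain ⟨i₁, e₁⟩ := integral_prod_indicator_dist_fst σ μ r hf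
  obtain ⟨i₂, e₂⟩ := integral_prod_indicator_dist_snd σ μ r hf
  obtain ⟨i₃, e₃⟩ := integral_prod_indicator_dist_fst σ μ r (f := fun _ => ω) continuous_const
  have h₁ := abs_integral_mul_sub_le σ hf (measurable_measureReal_ball μ r) hC hμ
  have h₂ := abs_integral_mul_sub_le μ hf (measurable_measureReal_ball σ r) hC hσ
  have h₃ := abs_integral_mul_sub_le σ (f := fun _ => ω) continuous_const
    (measurable_measureReal_ball μ r) (fun _ => (abs_of_nonneg hω₀).le) hμ
  rw [← e₁] at h₁
  rw [← e₂] at h₂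
  rw [← e₃] at h₃
  have h₄ := norm_integral_le_of_norm_le i₃ (ae_of_all _ fun p => by
    show ‖({p : X × X | dist p.1 p.2 < r}.indicator (fun p => f p.1) p -
      {p : X × X | dist p.1 p.2 < r}.indicator (fun p => f p.2) p)‖ ≤ _
    by_cases hp : dist p.1 p.2 < r
    · simpa [Set.indicator, hp] using hω _ _ hp
    · simp [Set.indicator, hp])
  rw [integral_sub i₁ i₂, Real.norm_eq_abs] at h₄
  simp only [integral_const, probReal_univ, one_smul] at h₃
  rw [abs_le] at h₁ h₂ h₃ h₄
  have key : |v * (∫ x, f x ∂μ - ∫ x, f x ∂σ)| ≤ v * (2 * η * C + ω * (1 + η)) := by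
    rw [abs_le]
    constructor <;> linarith [h₁.1, h₁.2, h₂.1, h₂.2, h₃.2, h₄.1, h₄.2]
  rw [abs_mul, abs_of_pos hv] at key
  exact le_of_mul_le_mul_left key hv

end BallAveraging

/-- **Abstract equidistribution principle.**
On a compact metric space with a Borel probability measure `σ` charging all balls and
with asymptotically center-independent ball measures, any sequence of Borel
probability measures `μ_n` whose measures of balls of radii `r_n → 0` are uniformly
comparable to those of `σ` converges to `σ` in the weak-* topology. -/
theorem stmt_11 {X : Type*} [MetricSpace X] [CompactSpace X]
    [MeasurableSpace X] [BorelSpace X]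
    (σ : Measure X) [IsProbabilityMeasure σ]
    (hpos : ∀ (z : X) (r : ℝ), 0 < r → 0 < σ (ball z r))
    (hσreg : ∀ ε > (0:ℝ), ∃ r₀ > (0:ℝ), ∀ r : ℝ, 0 < r → r < r₀ → ∀ z w : X,
      |(σ (ball w r)).toReal / (σ (ball z r)).toReal - 1| < ε)
    (μ : ℕ → Measure X) (hμ : ∀ n, IsProbabilityMeasure (μ n))
    (r : ℕ → ℝ) (hrpos : ∀ n, 0 < r n) (hr0 : Tendsto r atTop (nhds 0))
    (hunif : ∀ ε > (0:ℝ), ∃ N : ℕ, ∀ n ≥ N, ∀ z : X,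
      |((μ n) (ball z (r n))).toReal / (σ (ball z (r n))).toReal - 1| < ε) :
    ∀ f : X → ℝ, Continuous f →
      Tendsto (fun n => ∫ x, f x ∂(μ n)) atTop (nhds (∫ x, f x ∂σ)) := by
  intro f hf
  have := hμ
  obtain ⟨z₀⟩ : Nonempty X := nonempty_of_isProbabilityMeasure σ
  obtain ⟨C, hC⟩ := isCompact_univ.exists_bound_of_continuousOn hf.continuousOn
  replace hC : ∀ x, |f x| ≤ C := fun x => hC x trivial
  have hC₀ : 0 ≤ C := (abs_nonneg _).trans (hC z₀)
  have huc := Metric.uniformContinuous_iff.1 (CompactSpace.uniformContinuous_of_continuous hf)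
  rw [Metric.tendsto_atTop]
  intro ε hε
  have hD : 0 < 6 * C + 5 := by linarith
  set δ : ℝ := min 1 (ε / (6 * C + 5))
  have hδ₀ : 0 < δ := lt_min one_pos (div_pos hε hD)
  have hδ₁ : δ ≤ 1 := min_le_left _ _
  have hδε : δ * (6 * C + 5) ≤ ε := (le_div_iff₀ hD).1 (min_le_right _ _)
  obtain ⟨r₀, hr₀, hreg⟩ := hσreg δ hδ₀
  obtain ⟨ρ, hρ, hosc⟩ := huc δ hδ₀
  obtain ⟨N₁, hN₁⟩ := hunif δ hδ₀
  obtain ⟨N₂, hN₂⟩ := eventually_atTop.1 (hr0.eventually_lt_const (lt_min hr₀ hρ))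
  refine ⟨max N₁ N₂, fun n hn => ?_⟩
  have hrn := hN₂ n (le_of_max_le_right hn)
  have hball : ∀ z, 0 < σ.real (ball z (r n)) := fun z =>
    ENNReal.toReal_pos (hpos z _ (hrpos n)).ne' (measure_ne_top _ _)
  have hratio : ∀ {a b : ℝ}, 0 < b → |a / b - 1| < δ → |a - b| ≤ δ * b := by
    intro a b hb h
    have : a - b = (a / b - 1) * b := by field_simp
    rw [this, abs_mul, abs_of_pos hb]
    exact mul_le_mul_of_nonneg_right h.le hb.le
  set v := σ.real (ball z₀ (r n))
  have hv₀ : 0 < v := hball z₀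
  have hσv : ∀ z, |σ.real (ball z (r n)) - v| ≤ δ * v := fun z =>
    hratio hv₀ (hreg (r n) (hrpos n) (hrn.trans_le (min_le_left _ _)) z₀ z)
  have hμv : ∀ z, |(μ n).real (ball z (r n)) - v| ≤ 3 * δ * v := by
    intro z
    have h₁ := hratio (hball z) (hN₁ n (le_of_max_le_left hn) z)
    change |(μ n).real (ball z (r n)) - _| ≤ _ at h₁
    have h₂ := hσv z
    have h₃ : σ.real (ball z (r n)) ≤ 2 * v := by
      nlinarith [(abs_le.1 h₂).2]
    have h₄ := mul_le_mul_of_nonneg_left h₃ hδ₀.le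
    rw [abs_le] at h₁ h₂ ⊢
    constructor <;> linarith [h₁.1, h₁.2, h₂.1, h₂.2]
  have hmain := abs_integral_sub_integral_le σ (μ n) hf hv₀
    (fun z => (hσv z).trans (by nlinarith [mul_pos hδ₀ hv₀])) hμv hC hδ₀.le
    (fun x y hxy => (hosc (hxy.trans (hrn.trans_le (min_le_right _ _)))).le)
  rw [Real.dist_eq]
  nlinarith
end

section
/- Let 𝕋² = (ℝ/ℤ)² be the flat torus with its quotient metric d and Haar probability measure, and for L ≥ 1 let E_L ⊆ L²(𝕋²) be the linear span of the characters e_{n,m}(x, y) = exp(2πi(nx + my)) over pairs (n, m) ∈ ℤ² with 4π²(n² + m²) ≤ L², with k_L = dim E_L. Let Z = {Z(L)}_{L≥1}, Z(L) = {z_{L1}, …, z_{Lm_L}} ⊂ 𝕋², be a triangular family with m_L ≥ k_L which is an L²-Marcinkiewicz–Zygmund family: there is C > 0 such that for all L ≥ 1 and all f ∈ E_L, C^{-1} k_L^{-1} Σ_{j=1}^{m_L} |f(z_{Lj})|² ≤ ∫_{𝕋²} |f|² ≤ C k_L^{-1} Σ_{j=1}^{m_L} |f(z_{Lj})|². Then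 there exists a uniformly separated triangular family Z̃ with Z̃(L) ⊆ Z(L) for all L which is also an L²-Marcinkiewicz–Zygmund family and whose lower Beurling–Landau density satisfies D⁻(Z̃) ≥ 1, where D⁻(Z̃) = liminf_{R→∞} liminf_{L→∞} min_{ξ∈𝕋²} [k_L^{-1} #(Z̃(L) ∩ B(ξ, R/L))] / vol(B(ξ, R/L)). -/
open MeasureTheory Filter

noncomputable section

/-- The flat torus `𝕋² = (ℝ/ℤ)²`, with its product (quotient) metric and Haar
probability measure. -/
abbrev T2 := AddCircle (1 : ℝ) × AddCircle (1 : ℝ)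

/-- The character `e_{n,m}(x,y) = exp(2πi(nx+my))` on `𝕋²`. -/
noncomputable def eChar (n m : ℤ) : T2 → ℂ := fun p => fourier n p.1 * fourier m p.2

/-- `E_L`: the span of the characters `e_{n,m}` with `4π²(n²+m²) ≤ L²`,
i.e. of the eigenfunctions of the Laplacian on `𝕋²` with eigenvalue at most `L²`. -/
noncomputable def EL (L : ℝ) : Submodule ℂ (T2 → ℂ) :=
  Submodule.span ℂ {f | ∃ n m : ℤ,
    4 * Real.pi ^ 2 * ((n : ℝ) ^ 2 + (m : ℝ) ^ 2) ≤ L ^ 2 ∧ f = eChar n m}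

/-- `k_L = dim E_L`. -/
noncomputable def kL (L : ℝ) : ℕ := Module.finrank ℂ (EL L)

open scoped ComplexConjugate

/-! ### Characters and trigonometric polynomials -/

/-- The character of `𝕋²` with frequency `l`. -/
def ch (l : ℤ × ℤ) (x : T2) : ℂ := eChar l.1 l.2 x

lemma continuous_ch (l : ℤ × ℤ) : Continuous (ch l) := by
  unfold ch eChar
  fun_prop

lemma ch_add_index (l v : ℤ × ℤ) (x : T2) : ch (l + v) x = ch l x * ch v x := by
  simp only [ch, eChar, Prod.fst_add, Prod.snd_add, fourier_add]
  ring

lemma ch_neg_index (l : ℤ × ℤ) (x : T2) : ch (-l) x = conj (ch l x) := by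
  simp [ch, eChar]

lemma fourier_add_arg (n : ℤ) (x y : AddCircle (1 : ℝ)) :
    fourier n (x + y) = fourier n x * fourier n y := by
  simp only [fourier_apply, smul_add, AddCircle.toCircle_add, Circle.coe_mul]

lemma ch_add (l : ℤ × ℤ) (x y : T2) : ch l (x + y) = ch l x * ch l y := by
  simp only [ch, eChar, Prod.fst_add, Prod.snd_add, fourier_add_arg]
  ring

lemma ch_neg (l : ℤ × ℤ) (x : T2) : ch l (-x) = conj (ch l x) := by
  simp [ch, eChar]

lemma ch_sub (l : ℤ × ℤ) (x y : T2) : ch l (x - y) = ch l x * conj (ch l y) := by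
  rw [sub_eq_add_neg, ch_add, ch_neg]

lemma norm_ch (l : ℤ × ℤ) (x : T2) : ‖ch l x‖ = 1 := by
  simp only [ch, eChar, fourier_apply, norm_mul, Circle.norm_coe, mul_one]

lemma ch_mul_conj (l : ℤ × ℤ) (x : T2) : ch l x * conj (ch l x) = 1 := by
  rw [Complex.mul_conj, Complex.normSq_eq_norm_sq, norm_ch]
  simp

lemma ch_zero_arg (l : ℤ × ℤ) : ch l 0 = 1 := by
  simp [ch, eChar]

lemma integral_fourier (n : ℤ) :
    ∫ x : AddCircle (1 : ℝ), fourier n x = if n = 0 then 1 else 0 := by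
  split_ifs with h
  · subst h
    simp [measureReal_def]
  · exact integral_eq_zero_of_add_right_eq_neg (μ := (volume : Measure (AddCircle (1 : ℝ))))
      (fourier_add_half_inv_index h one_pos)

lemma integral_ch (l : ℤ × ℤ) : ∫ x : T2, ch l x = if l = 0 then 1 else 0 := by
  have : ∫ x : T2, ch l x =
      (∫ x : AddCircle (1 : ℝ), fourier l.1 x) * ∫ x : AddCircle (1 : ℝ), fourier l.2 x := by
    rw [← integral_prod_mul]
    rfl
  rw [this, integral_fourier, integral_fourier]
  by_cases h1 : l.1 = 0 <;> by_cases h2 : l.2 = 0 <;> simp [h1, h2, Prod.ext_iff]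

lemma integrable_of_continuous {f : T2 → ℂ} (hf : Continuous f) : Integrable f :=
  hf.integrable_of_hasCompactSupport (HasCompactSupport.of_compactSpace f)

lemma integrable_real_of_continuous {f : T2 → ℝ} (hf : Continuous f) : Integrable f :=
  hf.integrable_of_hasCompactSupport (HasCompactSupport.of_compactSpace f)

/-- The trigonometric polynomial with coefficients `a` on the finite spectrum `S`. -/
def trigPoly (S : Finset (ℤ × ℤ)) (a : ℤ × ℤ → ℂ) (x : T2) : ℂ := ∑ l ∈ S, a l * ch l x

lemma continuous_trigPoly (S : Finset (ℤ × ℤ)) (a : ℤ × ℤ → ℂ) : Continuous (trigPoly S a) := by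
  unfold trigPoly
  exact continuous_finsetSum _ fun l _ => continuous_const.mul (continuous_ch l)

lemma integral_trigPoly_mul_conj (S : Finset (ℤ × ℤ)) (a b : ℤ × ℤ → ℂ) :
    ∫ x : T2, trigPoly S a x * conj (trigPoly S b x) = ∑ l ∈ S, a l * conj (b l) := by
  have h : ∀ x : T2, trigPoly S a x * conj (trigPoly S b x) =
      ∑ l ∈ S, ∑ k ∈ S, a l * conj (b k) * ch (l - k) x := by
    intro x
    simp only [trigPoly, map_sum, Finset.sum_mul_sum, map_mul, sub_eq_add_neg, ch_add_index,
      ch_neg_index]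
    refine Finset.sum_congr rfl fun l _ => Finset.sum_congr rfl fun k _ => ?_
    ring
  simp_rw [h]
  have hi : ∀ l k : ℤ × ℤ, Integrable fun x : T2 => a l * conj (b k) * ch (l - k) x := fun l k =>
    integrable_of_continuous (continuous_const.mul (continuous_ch _))
  rw [integral_finsetSum _ fun l _ => integrable_finsetSum _ fun k _ => hi l k]
  refine Finset.sum_congr rfl fun l hl => ?_
  rw [integral_finsetSum _ fun k _ => hi l k]
  simp_rw [integral_const_mul, integral_ch, sub_eq_zero]
  simp [hl]

lemma integral_norm_sq_trigPoly (S : Finset (ℤ × ℤ)) (a : ℤ × ℤ → ℂ) :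
    ∫ x : T2, ‖trigPoly S a x‖ ^ 2 = ∑ l ∈ S, ‖a l‖ ^ 2 := by
  have h := integral_trigPoly_mul_conj S a a
  simp_rw [Complex.mul_conj, Complex.normSq_eq_norm_sq] at h
  rw [integral_complex_ofReal] at h
  exact_mod_cast h

/-! ### The spectrum of `E_L` -/

/-- The set of frequencies of `E_L`. -/
def freqs (L : ℝ) : Finset (ℤ × ℤ) :=
  ((Finset.Icc (-⌊|L|⌋) ⌊|L|⌋) ×ˢ (Finset.Icc (-⌊|L|⌋) ⌊|L|⌋)).filter
    fun l => 4 * Real.pi ^ 2 * ((l.1 : ℝ) ^ 2 + (l.2 : ℝ) ^ 2) ≤ L ^ 2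

lemma abs_le_of_sq_freq_le {L : ℝ} {n m : ℤ}
    (h : 4 * Real.pi ^ 2 * ((n : ℝ) ^ 2 + (m : ℝ) ^ 2) ≤ L ^ 2) :
    2 * Real.pi * |(n : ℝ)| ≤ |L| ∧ 2 * Real.pi * |(m : ℝ)| ≤ |L| := by
  have key : ∀ t : ℝ, 4 * Real.pi ^ 2 * t ^ 2 ≤ L ^ 2 → 2 * Real.pi * |t| ≤ |L| := by
    intro t ht
    have := sq_le_sq.1 (show (2 * Real.pi * t) ^ 2 ≤ L ^ 2 by nlinarith)
    rwa [abs_mul, abs_of_pos (by positivity : (0 : ℝ) < 2 * Real.pi)] at this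
  have hp := sq_nonneg Real.pi
  constructor
  · exact key n (by nlinarith [mul_nonneg hp (sq_nonneg (m : ℝ))])
  · exact key m (by nlinarith [mul_nonneg hp (sq_nonneg (n : ℝ))])

lemma mem_freqs {L : ℝ} {l : ℤ × ℤ} :
    l ∈ freqs L ↔ 4 * Real.pi ^ 2 * ((l.1 : ℝ) ^ 2 + (l.2 : ℝ) ^ 2) ≤ L ^ 2 := by
  simp only [freqs, Finset.mem_filter, Finset.mem_product, Finset.mem_Icc, and_iff_right_iff_imp]
  intro h
  have hpi := Real.pi_gt_three
  obtain ⟨h1, h2⟩ := abs_le_of_sq_freq_le h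
  have key : ∀ n : ℤ, 2 * Real.pi * |(n : ℝ)| ≤ |L| → -⌊|L|⌋ ≤ n ∧ n ≤ ⌊|L|⌋ := by
    intro n hn
    rw [← abs_le, Int.le_floor]
    push_cast
    nlinarith [abs_nonneg (n : ℝ)]
  exact ⟨key _ h1, key _ h2⟩

lemma EL_eq (L : ℝ) : EL L = Submodule.span ℂ (Set.range fun l : freqs L => ch l) := by
  unfold EL
  congr 1
  ext f
  constructor
  · rintro ⟨n, m, h, rfl⟩
    exact ⟨⟨(n, m), mem_freqs.2 h⟩, rfl⟩
  · rintro ⟨⟨l, hl⟩, rfl⟩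
    exact ⟨l.1, l.2, mem_freqs.1 hl, rfl⟩

lemma mem_EL_iff {L : ℝ} {f : T2 → ℂ} : f ∈ EL L ↔ ∃ a, f = trigPoly (freqs L) a := by
  rw [EL_eq]
  constructor
  · intro h
    obtain ⟨c, rfl⟩ := (Submodule.mem_span_range_iff_exists_fun ℂ).1 h
    classical
    refine ⟨fun l => if h : l ∈ freqs L then c ⟨l, h⟩ else 0, ?_⟩
    ext x
    rw [trigPoly, ← Finset.sum_coe_sort (freqs L)]
    simp
  · rintro ⟨a, rfl⟩
    have : trigPoly (freqs L) a = ∑ l ∈ freqs L, a l • ch l := by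
      ext x
      simp [trigPoly]
    rw [this]
    exact Submodule.sum_mem _ fun l hl =>
      Submodule.smul_mem _ _ (Submodule.subset_span ⟨⟨l, hl⟩, rfl⟩)

lemma kL_eq_card (L : ℝ) : kL L = (freqs L).card := by
  have hli : LinearIndependent ℂ (fun l : freqs L => ch l) := by
    rw [Fintype.linearIndependent_iff]
    intro g hg
    classical
    let a : ℤ × ℤ → ℂ := fun l => if h : l ∈ freqs L then g ⟨l, h⟩ else 0
    have h0 : trigPoly (freqs L) a = 0 := by
      rw [← hg]
      ext x
      rw [trigPoly, ← Finset.sum_coe_sort (freqs L)]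
      simp [a]
    have h1 := integral_norm_sq_trigPoly (freqs L) a
    rw [h0] at h1
    simp only [Pi.zero_apply, norm_zero, ne_eq, OfNat.ofNat_ne_zero, not_false_eq_true, zero_pow,
      integral_zero] at h1
    intro i
    have h2 := (Finset.sum_eq_zero_iff_of_nonneg (fun l _ => sq_nonneg ‖a l‖)).1 h1.symm i i.2
    simpa [a] using h2
  rw [kL, EL_eq, finrank_span_eq_card hli, Fintype.card_coe]

lemma zero_mem_freqs (L : ℝ) : (0 : ℤ × ℤ) ∈ freqs L := by
  rw [mem_freqs]
  simpa using sq_nonneg L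

lemma card_freqs_pos (L : ℝ) : 0 < (freqs L).card := Finset.card_pos.2 ⟨0, zero_mem_freqs L⟩

lemma kL_pos (L : ℝ) : (0 : ℝ) < kL L := by
  rw [kL_eq_card]
  exact_mod_cast card_freqs_pos L

/-- Weyl-type lower bound for the dimension. -/
lemma sq_le_mul_kL (L : ℝ) (hL : 0 ≤ L) : L ^ 2 ≤ 80 * (kL L : ℝ) := by
  set N : ℕ := ⌊L / (2 * Real.pi * Real.sqrt 2)⌋₊ with hN
  have hpi := Real.pi_gt_three
  have hpi' := Real.pi_lt_d2
  have hD : 0 < 2 * Real.pi * Real.sqrt 2 := by positivity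
  have h0 : 0 ≤ L / (2 * Real.pi * Real.sqrt 2) := by positivity
  have hle : (N : ℝ) * (2 * Real.pi * Real.sqrt 2) ≤ L := by
    rw [← le_div_iff₀ hD]
    exact Nat.floor_le h0
  have hs : Real.sqrt 2 ^ 2 = 2 := Real.sq_sqrt (by norm_num)
  have hsub : (Finset.Icc (-(N : ℤ)) N) ×ˢ (Finset.Icc (-(N : ℤ)) N) ⊆ freqs L := by
    intro l hl
    simp only [Finset.mem_product, Finset.mem_Icc, ← abs_le] at hl
    rw [mem_freqs]
    have h1 : (l.1 : ℝ) ^ 2 ≤ N ^ 2 := by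
      rw [sq_le_sq, Nat.abs_cast]
      exact_mod_cast hl.1
    have h2 : (l.2 : ℝ) ^ 2 ≤ N ^ 2 := by
      rw [sq_le_sq, Nat.abs_cast]
      exact_mod_cast hl.2
    have h3 : ((N : ℝ) * (2 * Real.pi * Real.sqrt 2)) ^ 2 ≤ L ^ 2 := by gcongr
    have h4 : ((N : ℝ) * (2 * Real.pi * Real.sqrt 2)) ^ 2 = 4 * Real.pi ^ 2 * (N ^ 2 + N ^ 2) := by
      rw [mul_pow, mul_pow, hs]; ring
    calc 4 * Real.pi ^ 2 * ((l.1 : ℝ) ^ 2 + (l.2 : ℝ) ^ 2)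
        ≤ 4 * Real.pi ^ 2 * ((N : ℝ) ^ 2 + (N : ℝ) ^ 2) := by gcongr
      _ ≤ L ^ 2 := h4 ▸ h3
  have hc := Finset.card_le_card hsub
  rw [Finset.card_product, Int.card_Icc, ← kL_eq_card] at hc
  have hc' : ((2 * N + 1 : ℕ) : ℝ) * ((2 * N + 1 : ℕ) : ℝ) ≤ kL L := by
    have : ((N : ℤ) + 1 - -(N : ℤ)).toNat = 2 * N + 1 := by omega
    rw [this] at hc
    exact_mod_cast hc
  have hy : L / (2 * Real.pi * Real.sqrt 2) ≤ ((2 * N + 1 : ℕ) : ℝ) := by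
    have := (Nat.lt_floor_add_one (L / (2 * Real.pi * Real.sqrt 2))).le
    push_cast
    have h5 : (0 : ℝ) ≤ N := Nat.cast_nonneg _
    rw [← hN] at this
    linarith
  rw [div_le_iff₀ hD] at hy
  set q : ℝ := ((2 * N + 1 : ℕ) : ℝ)
  have hq : 0 ≤ q := Nat.cast_nonneg _
  calc L ^ 2 ≤ (q * (2 * Real.pi * Real.sqrt 2)) ^ 2 := by gcongr
    _ = q * q * (8 * Real.pi ^ 2) := by rw [mul_pow, mul_pow, hs]; ring
    _ ≤ (kL L : ℝ) * 80 := by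
        refine mul_le_mul hc' ?_ (by positivity) (by positivity)
        nlinarith
    _ = _ := mul_comm _ _

/-! ### Perturbation of sampling points -/

/-- Stability of a Bessel bound under a small perturbation of the frequencies' phases. -/
lemma sum_norm_sq_phase_sub_one_le {ι κ : Type*} (S : Finset ι) (J : Finset κ) (v : ι → κ → ℂ)
    {B : ℝ} (hB : ∀ a : ι → ℂ,
      ∑ j ∈ J, ‖∑ l ∈ S, a l * v l j‖ ^ 2 ≤ B * ∑ l ∈ S, ‖a l‖ ^ 2)
    (θ : ι → ℝ) (s : κ → ℝ) {M ε : ℝ} (hM : 0 ≤ M) (hθ : ∀ l ∈ S, |θ l| ≤ M)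
    (hs : ∀ j ∈ J, M * |s j| ≤ ε) (hB0 : 0 ≤ B) (hε : 0 ≤ ε) (a : ι → ℂ) :
    ∑ j ∈ J, ‖∑ l ∈ S, a l * v l j * (Complex.exp (θ l * s j * Complex.I) - 1)‖ ^ 2 ≤
      (Real.exp ε - 1) ^ 2 * B * ∑ l ∈ S, ‖a l‖ ^ 2 := by
  set A : ℝ := ∑ l ∈ S, ‖a l‖ ^ 2 with hA
  have hA0 : 0 ≤ A := Finset.sum_nonneg fun _ _ => sq_nonneg _
  let X : ℕ → EuclideanSpace ℂ J := fun k => WithLp.toLp 2 fun j =>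
    ∑ l ∈ S, a l * v l j * ((θ l * s j * Complex.I) ^ (k + 1) / ((k + 1).factorial : ℂ))
  let Y : EuclideanSpace ℂ J := WithLp.toLp 2 fun j =>
    ∑ l ∈ S, a l * v l j * (Complex.exp (θ l * s j * Complex.I) - 1)
  have hXY : HasSum X Y := by
    rw [← (PiLp.continuousLinearEquiv 2 ℂ (fun _ : J => ℂ)).hasSum', Pi.hasSum]
    intro j
    refine hasSum_sum fun l _ => HasSum.mul_left _ ?_
    have h := NormedSpace.expSeries_div_hasSum_exp (𝔸 := ℂ) ((θ l * s j * Complex.I : ℂ))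
    rw [← Complex.exp_eq_exp_ℂ] at h
    simpa using (hasSum_nat_add_iff' 1).2 h
  have hgsum : HasSum (fun k : ℕ => ε ^ (k + 1) / ((k + 1).factorial : ℝ) * Real.sqrt (B * A))
      ((Real.exp ε - 1) * Real.sqrt (B * A)) := by
    refine HasSum.mul_right _ ?_
    have h := NormedSpace.expSeries_div_hasSum_exp (𝔸 := ℝ) ε
    rw [← Real.exp_eq_exp_ℝ] at h
    simpa using (hasSum_nat_add_iff' 1).2 h
  have hbound : ∀ k, ‖X k‖ ≤ ε ^ (k + 1) / ((k + 1).factorial : ℝ) * Real.sqrt (B * A) := by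
    intro k
    rw [EuclideanSpace.norm_eq]
    refine Real.sqrt_le_iff.2 ⟨by positivity, ?_⟩
    rw [mul_pow, Real.sq_sqrt (by positivity)]
    set c : ℝ := ε ^ (k + 1) / ((k + 1).factorial : ℝ)
    have hM1 : M = 0 ∨ M ≠ 0 := eq_or_ne _ _
    have hθM : ∀ l ∈ S, |θ l / M| ≤ 1 := by
      intro l hl
      rcases hM1 with h | h
      · simp [h]
      · rw [abs_div, abs_of_nonneg hM]
        exact div_le_one_of_le₀ (hθ l hl) hM
    have hfac : ∀ l ∈ S, ((θ l : ℂ)) = (M : ℂ) * ((θ l / M : ℝ) : ℂ) := by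
      intro l hl
      rcases hM1 with h | h
      · have := hθ l hl
        rw [h, abs_nonpos_iff] at this
        simp [this]
      · rw [← Complex.ofReal_mul, mul_div_cancel₀ _ h]
    have hterm : ∀ j : J, ‖X k j‖ ^ 2 ≤
        c ^ 2 * ‖∑ l ∈ S, (a l * ((θ l / M : ℝ) : ℂ) ^ (k + 1)) * v l j‖ ^ 2 := by
      intro j
      have : X k j = (((M : ℂ) * s j * Complex.I) ^ (k + 1) / ((k + 1).factorial : ℂ)) *
          ∑ l ∈ S, (a l * ((θ l / M : ℝ) : ℂ) ^ (k + 1)) * v l j := by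
        simp only [X]
        rw [Finset.mul_sum]
        refine Finset.sum_congr rfl fun l hl => ?_
        rw [hfac l hl]
        ring
      rw [this, norm_mul, mul_pow]
      gcongr
      rw [norm_div, norm_pow, norm_mul, norm_mul, Complex.norm_I, mul_one, Complex.norm_real,
        Complex.norm_real, Complex.norm_natCast, Real.norm_eq_abs, Real.norm_eq_abs,
        abs_of_nonneg hM]
      simp only [c]
      gcongr
      exact hs j j.2
    calc ∑ j : J, ‖X k j‖ ^ 2
        ≤ ∑ j : J, c ^ 2 * ‖∑ l ∈ S, (a l * ((θ l / M : ℝ) : ℂ) ^ (k + 1)) * v l j‖ ^ 2 :=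
          Finset.sum_le_sum fun j _ => hterm j
      _ = c ^ 2 * ∑ j ∈ J, ‖∑ l ∈ S, (a l * ((θ l / M : ℝ) : ℂ) ^ (k + 1)) * v l j‖ ^ 2 := by
          rw [← Finset.mul_sum, Finset.sum_coe_sort J
            (fun j => ‖∑ l ∈ S, (a l * ((θ l / M : ℝ) : ℂ) ^ (k + 1)) * v l j‖ ^ 2)]
      _ ≤ c ^ 2 * (B * A) := by
          gcongr
          refine (hB _).trans (mul_le_mul_of_nonneg_left (Finset.sum_le_sum fun l hl => ?_) hB0)
          gcongr
          rw [norm_mul, norm_pow, Complex.norm_real]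
          exact mul_le_of_le_one_right (norm_nonneg _) (pow_le_one₀ (abs_nonneg _) (hθM l hl))
  have hfin := HasSum.norm_le_of_bounded hXY hgsum hbound
  have h1 : ‖Y‖ ^ 2 ≤ ((Real.exp ε - 1) * Real.sqrt (B * A)) ^ 2 := by gcongr
  rw [EuclideanSpace.norm_sq_eq, mul_pow, Real.sq_sqrt (by positivity), ← mul_assoc] at h1
  rw [← Finset.sum_coe_sort J]
  exact h1

/-- Perturbation of the sampling points of trigonometric polynomials in both coordinates. -/
lemma sum_norm_sq_phase_mul_phase_sub_one_le {ι κ : Type*} (S : Finset ι) (J : Finset κ)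
    (v : ι → κ → ℂ) {B : ℝ} (hB : ∀ a : ι → ℂ,
      ∑ j ∈ J, ‖∑ l ∈ S, a l * v l j‖ ^ 2 ≤ B * ∑ l ∈ S, ‖a l‖ ^ 2)
    (θ η : ι → ℝ) (s t : κ → ℝ) {M ε : ℝ} (hM : 0 ≤ M) (hθ : ∀ l ∈ S, |θ l| ≤ M)
    (hη : ∀ l ∈ S, |η l| ≤ M) (hs : ∀ j ∈ J, M * |s j| ≤ ε) (ht : ∀ j ∈ J, M * |t j| ≤ ε)
    (hB0 : 0 ≤ B) (hε : 0 ≤ ε) (hε1 : ε ≤ 1) (a : ι → ℂ) :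
    ∑ j ∈ J, ‖∑ l ∈ S, a l * v l j *
      (Complex.exp (θ l * s j * Complex.I) * Complex.exp (η l * t j * Complex.I) - 1)‖ ^ 2 ≤
      88 * ε ^ 2 * B * ∑ l ∈ S, ‖a l‖ ^ 2 := by
  have he : (Real.exp ε - 1) ^ 2 ≤ 4 * ε ^ 2 := by
    have h := Real.abs_exp_sub_one_le (x := ε) (by rwa [abs_of_nonneg hε])
    rw [abs_of_nonneg hε] at h
    calc (Real.exp ε - 1) ^ 2 = |Real.exp ε - 1| ^ 2 := (sq_abs _).symm
      _ ≤ (2 * ε) ^ 2 := by gcongr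
      _ = _ := by ring
  have hsq : ∀ x y : ℂ, ‖x + y‖ ^ 2 ≤ 2 * ‖x‖ ^ 2 + 2 * ‖y‖ ^ 2 := by
    intro x y
    have := norm_add_le x y
    nlinarith [norm_nonneg (x + y), sq_nonneg (‖x‖ - ‖y‖)]
  have hbase : ∀ a : ι → ℂ, ∑ j ∈ J, ‖∑ l ∈ S, a l * v l j *
      (Complex.exp (η l * t j * Complex.I) - 1)‖ ^ 2 ≤ 4 * ε ^ 2 * B * ∑ l ∈ S, ‖a l‖ ^ 2 := by
    intro a
    refine (sum_norm_sq_phase_sub_one_le S J v hB η t hM hη ht hB0 hε a).trans ?_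
    gcongr
  have hB' : ∀ a : ι → ℂ, ∑ j ∈ J, ‖∑ l ∈ S, a l *
      (v l j * Complex.exp (η l * t j * Complex.I))‖ ^ 2 ≤ 10 * B * ∑ l ∈ S, ‖a l‖ ^ 2 := by
    intro a
    have h1 := hbase a
    have h2 := hB a
    have h3 : ∀ j ∈ J, ‖∑ l ∈ S, a l * (v l j * Complex.exp (η l * t j * Complex.I))‖ ^ 2 ≤
        2 * ‖∑ l ∈ S, a l * v l j * (Complex.exp (η l * t j * Complex.I) - 1)‖ ^ 2 +
        2 * ‖∑ l ∈ S, a l * v l j‖ ^ 2 := by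
      intro j _
      refine le_trans (le_of_eq ?_) (hsq _ _)
      rw [← Finset.sum_add_distrib]
      congr 3
      ext l
      ring
    have h4 := Finset.sum_le_sum h3
    rw [Finset.sum_add_distrib, ← Finset.mul_sum, ← Finset.mul_sum] at h4
    have hA0 : 0 ≤ B * ∑ l ∈ S, ‖a l‖ ^ 2 :=
      mul_nonneg hB0 (Finset.sum_nonneg fun _ _ => sq_nonneg _)
    have h5 : ε ^ 2 * (B * ∑ l ∈ S, ‖a l‖ ^ 2) ≤ 1 * (B * ∑ l ∈ S, ‖a l‖ ^ 2) := by
      gcongr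
      exact pow_le_one₀ hε hε1
    nlinarith
  have h6 := sum_norm_sq_phase_sub_one_le S J _ hB' θ s hM hθ hs (by positivity) hε a
  have h7 := hbase a
  have h8 : ∀ j ∈ J, ‖∑ l ∈ S, a l * v l j *
      (Complex.exp (θ l * s j * Complex.I) * Complex.exp (η l * t j * Complex.I) - 1)‖ ^ 2 ≤
      2 * ‖∑ l ∈ S, a l * (v l j * Complex.exp (η l * t j * Complex.I)) *
        (Complex.exp (θ l * s j * Complex.I) - 1)‖ ^ 2 +
      2 * ‖∑ l ∈ S, a l * v l j * (Complex.exp (η l * t j * Complex.I) - 1)‖ ^ 2 := by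
    intro j _
    refine le_trans (le_of_eq ?_) (hsq _ _)
    rw [← Finset.sum_add_distrib]
    congr 3
    ext l
    ring
  have h9 := Finset.sum_le_sum h8
  rw [Finset.sum_add_distrib, ← Finset.mul_sum, ← Finset.mul_sum] at h9
  have hA0 : 0 ≤ B * ∑ l ∈ S, ‖a l‖ ^ 2 :=
    mul_nonneg hB0 (Finset.sum_nonneg fun _ _ => sq_nonneg _)
  have h10 : (Real.exp ε - 1) ^ 2 * (10 * B) * ∑ l ∈ S, ‖a l‖ ^ 2 ≤
      4 * ε ^ 2 * (10 * B) * ∑ l ∈ S, ‖a l‖ ^ 2 := by gcongr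
  nlinarith

/-! ### Local coordinates, multiplicity, and extraction of a separated subfamily -/

lemma exists_real_rep (x : AddCircle (1 : ℝ)) : ∃ r : ℝ, (r : AddCircle (1 : ℝ)) = x ∧ |r| = ‖x‖ := by
  obtain ⟨y, rfl⟩ := QuotientAddGroup.mk_surjective x
  refine ⟨y - round y, ?_, (UnitAddCircle.norm_eq (x := y)).symm⟩
  have h : ((round y : ℝ) : AddCircle (1 : ℝ)) = 0 :=
    (AddCircle.coe_eq_zero_iff 1).2 ⟨round y, by simp⟩
  rw [AddCircle.coe_sub, h, sub_zero]

lemma ch_real (l : ℤ × ℤ) (s t : ℝ) : ch l ((s : AddCircle (1 : ℝ)), (t : AddCircle (1 : ℝ))) =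
    Complex.exp ((2 * Real.pi * l.1 : ℝ) * s * Complex.I) *
      Complex.exp ((2 * Real.pi * l.2 : ℝ) * t * Complex.I) := by
  simp only [ch, eChar, fourier_coe_apply]
  push_cast
  congr 2 <;> ring

lemma exists_local_coords (p q : T2) : ∃ s t : ℝ, |s| ≤ dist p q ∧ |t| ≤ dist p q ∧
    ∀ l, ch l p = ch l q * (Complex.exp ((2 * Real.pi * l.1 : ℝ) * s * Complex.I) *
      Complex.exp ((2 * Real.pi * l.2 : ℝ) * t * Complex.I)) := by
  obtain ⟨s, hs, hs'⟩ := exists_real_rep (p - q).1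
  obtain ⟨t, ht, ht'⟩ := exists_real_rep (p - q).2
  refine ⟨s, t, ?_, ?_, fun l => ?_⟩
  · rw [hs', dist_eq_norm]
    exact norm_fst_le _
  · rw [ht', dist_eq_norm]
    exact norm_snd_le _
  · rw [← ch_real, hs, ht, ← ch_add]
    exact congrArg (ch l) (add_sub_cancel q p).symm

lemma abs_freq_le {L : ℝ} (hL : 0 ≤ L) {l : ℤ × ℤ} (hl : l ∈ freqs L) :
    |2 * Real.pi * (l.1 : ℝ)| ≤ L ∧ |2 * Real.pi * (l.2 : ℝ)| ≤ L := by
  have h := abs_le_of_sq_freq_le (mem_freqs.1 hl)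
  rwa [abs_of_nonneg hL, ← abs_of_pos (by positivity : (0 : ℝ) < 2 * Real.pi), ← abs_mul,
    ← abs_mul] at h

/-- The reproducing kernel of `E_L`. -/
def repKer (L : ℝ) (x y : T2) : ℂ := trigPoly (freqs L) (fun l => conj (ch l y)) x

lemma sum_norm_sq_conj_ch (S : Finset (ℤ × ℤ)) (y : T2) :
    ∑ l ∈ S, ‖conj (ch l y)‖ ^ 2 = (S.card : ℝ) := by
  simp [norm_ch]

lemma half_kL_le_norm_repKer {L : ℝ} (hL : 0 < L) {x y : T2} (h : dist x y ≤ 1 / 4 / L) :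
    (kL L : ℝ) / 2 ≤ ‖repKer L x y‖ := by
  refine le_trans ?_ (Complex.re_le_norm _)
  obtain ⟨s, t, hs, ht, hst⟩ := exists_local_coords x y
  rw [repKer, trigPoly, Complex.re_sum, kL_eq_card]
  have hterm : ∀ l ∈ freqs L, (1 / 2 : ℝ) ≤ (conj (ch l y) * ch l x).re := by
    intro l hl
    obtain ⟨h1, h2⟩ := abs_freq_le hL.le hl
    rw [hst, ← mul_assoc, mul_comm (conj _), ch_mul_conj, one_mul, ← Complex.exp_add]
    set θ : ℝ := 2 * Real.pi * l.1
    set η : ℝ := 2 * Real.pi * l.2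
    have he : (θ : ℂ) * s * Complex.I + (η : ℂ) * t * Complex.I =
        ((θ * s + η * t : ℝ) : ℂ) * Complex.I := by
      push_cast
      ring
    rw [he, Complex.exp_ofReal_mul_I_re]
    have hb : ∀ u v : ℝ, |u| ≤ L → |v| ≤ 1 / 4 / L → |u * v| ≤ 1 / 4 := by
      intro u v hu hv
      rw [abs_mul]
      calc |u| * |v| ≤ L * (1 / 4 / L) := by gcongr
        _ = 1 / 4 := by field_simp
    have h3 := hb θ s h1 (hs.trans h)
    have h4 := hb η t h2 (ht.trans h)
    have h5 : |θ * s + η * t| ≤ 1 / 2 := (abs_add_le _ _).trans (by linarith)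
    have h6 := Real.one_sub_sq_div_two_le_cos (x := θ * s + η * t)
    have h7 : (θ * s + η * t) ^ 2 ≤ (1 / 2) ^ 2 := by
      rw [← sq_abs]
      gcongr
    linarith
  calc ((freqs L).card : ℝ) / 2 = ∑ l ∈ freqs L, (1 / 2 : ℝ) := by
        rw [Finset.sum_const, nsmul_eq_mul]; ring
    _ ≤ _ := Finset.sum_le_sum hterm

/-- A Bessel bound controls the number of sampling points in a ball of radius `1 / (4L)`. -/
lemma card_mul_kL_le {κ : Type*} {L : ℝ} (hL : 0 < L) (J : Finset κ) (z : κ → T2) {B : ℝ}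
    (hB : ∀ a, ∑ j ∈ J, ‖trigPoly (freqs L) a (z j)‖ ^ 2 ≤ B * ∑ l ∈ freqs L, ‖a l‖ ^ 2)
    (p : T2) (h : ∀ j ∈ J, dist (z j) p ≤ 1 / 4 / L) : (J.card : ℝ) * kL L ≤ 4 * B := by
  have h1 := hB fun l => conj (ch l p)
  rw [sum_norm_sq_conj_ch, ← kL_eq_card] at h1
  have h2 : ∑ j ∈ J, ((kL L : ℝ) / 2) ^ 2 ≤ B * kL L := by
    refine le_trans (Finset.sum_le_sum fun j hj => ?_) h1
    have := half_kL_le_norm_repKer hL (h j hj)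
    rw [repKer] at this
    have hk := kL_pos L
    gcongr
  rw [Finset.sum_const, nsmul_eq_mul] at h2
  have hk := kL_pos L
  have h3 : ((J.card : ℝ) * kL L) * kL L ≤ (4 * B) * kL L := by nlinarith
  exact le_of_mul_le_mul_right h3 hk

lemma exists_maximal_separated {X : Type*} [PseudoMetricSpace X] (V : Finset X) {δ : ℝ} (hδ : 0 < δ) :
    ∃ W ⊆ V, (∀ p ∈ W, ∀ q ∈ W, p ≠ q → δ ≤ dist p q) ∧ ∀ p ∈ V, ∃ q ∈ W, dist p q < δ := by
  classical
  obtain ⟨W, hW, hmax⟩ := Finset.exists_max_image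
    (V.powerset.filter fun W => ∀ p ∈ W, ∀ q ∈ W, p ≠ q → δ ≤ dist p q) Finset.card
    ⟨∅, by simp⟩
  rw [Finset.mem_filter, Finset.mem_powerset] at hW
  refine ⟨W, hW.1, hW.2, fun p hp => ?_⟩
  by_contra! hcon
  have hpW : p ∉ W := fun h => by
    have := hcon p h
    rw [dist_self] at this
    linarith
  have := hmax (insert p W) (by
    rw [Finset.mem_filter, Finset.mem_powerset]
    refine ⟨Finset.insert_subset hp hW.1, ?_⟩
    intro a ha b hb hab
    rw [Finset.mem_insert] at ha hb
    rcases ha with rfl | ha <;> rcases hb with rfl | hb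
    · exact absurd rfl hab
    · exact hcon b hb
    · rw [dist_comm]
      exact hcon a ha
    · exact hW.2 a ha b hb hab)
  rw [Finset.card_insert_of_notMem hpW] at this
  omega

/-- Extraction of a separated Marcinkiewicz–Zygmund subfamily. -/
lemma exists_separated_subfamily {κ : Type*} {L : ℝ} (hL : 0 < L) (J : Finset κ) (z : κ → T2)
    {C ε : ℝ} (hC : 0 < C) (hε : 0 < ε) (hε1 : ε ≤ 1 / 4) (hεC : 20 * C * ε ≤ 1)
    (hup : ∀ a, ∑ j ∈ J, ‖trigPoly (freqs L) a (z j)‖ ^ 2 ≤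
      C * kL L * ∑ l ∈ freqs L, ‖a l‖ ^ 2)
    (hlow : ∀ a, (kL L : ℝ) * ∑ l ∈ freqs L, ‖a l‖ ^ 2 ≤
      C * ∑ j ∈ J, ‖trigPoly (freqs L) a (z j)‖ ^ 2) :
    ∃ W : Finset T2, (∀ w ∈ W, ∃ j ∈ J, w = z j) ∧
      (∀ p ∈ W, ∀ q ∈ W, p ≠ q → ε / L ≤ dist p q) ∧
      (∀ a, ∑ w ∈ W, ‖trigPoly (freqs L) a w‖ ^ 2 ≤ C * kL L * ∑ l ∈ freqs L, ‖a l‖ ^ 2) ∧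
      (∀ a, (kL L : ℝ) * ∑ l ∈ freqs L, ‖a l‖ ^ 2 ≤
        16 * C ^ 2 * ∑ w ∈ W, ‖trigPoly (freqs L) a w‖ ^ 2) := by
  classical
  obtain ⟨W, hWV, hsep, hcov⟩ := exists_maximal_separated (J.image z) (div_pos hε hL)
  have hWz : ∀ w ∈ W, ∃ j ∈ J, w = z j := fun w hw => by
    obtain ⟨j, hj, h⟩ := Finset.mem_image.1 (hWV hw)
    exact ⟨j, hj, h.symm⟩
  have hk := kL_pos L
  refine ⟨W, hWz, hsep, fun a => ?_, fun a => ?_⟩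
  · refine le_trans ?_ (hup a)
    refine (Finset.sum_le_sum_of_subset_of_nonneg hWV fun _ _ _ => sq_nonneg _).trans ?_
    exact Finset.sum_image_le_of_nonneg fun _ _ => sq_nonneg _
  · have hcov' : ∀ j : κ, ∃ q : T2, j ∈ J → q ∈ W ∧ dist q (z j) < ε / L := by
      intro j
      by_cases hj : j ∈ J
      · obtain ⟨q, hq, h⟩ := hcov (z j) (Finset.mem_image_of_mem z hj)
        exact ⟨q, fun _ => ⟨hq, by rwa [dist_comm]⟩⟩
      · exact ⟨0, fun h => absurd h hj⟩
    choose q hq using hcov'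
    choose s t hs ht hst using fun j => exists_local_coords (q j) (z j)
    set A : ℝ := ∑ l ∈ freqs L, ‖a l‖ ^ 2
    have hpert : ∑ j ∈ J, ‖trigPoly (freqs L) a (q j) - trigPoly (freqs L) a (z j)‖ ^ 2 ≤
        88 * ε ^ 2 * (C * kL L) * A := by
      have hM : ∀ u : ℝ, ∀ j ∈ J, |u| ≤ dist (q j) (z j) → L * |u| ≤ ε := by
        intro u j hj hu
        calc L * |u| ≤ L * (ε / L) := by
              gcongr
              exact hu.trans (hq j hj).2.le
          _ = ε := by field_simp
      refine le_trans (le_of_eq ?_) (sum_norm_sq_phase_mul_phase_sub_one_le (freqs L) J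
        (fun l j => ch l (z j)) hup (fun l => 2 * Real.pi * l.1) (fun l => 2 * Real.pi * l.2)
        s t hL.le (fun l hl => (abs_freq_le hL.le hl).1) (fun l hl => (abs_freq_le hL.le hl).2)
        (fun j hj => hM _ j hj (hs j)) (fun j hj => hM _ j hj (ht j)) (by positivity) hε.le
        (by linarith) a)
      refine Finset.sum_congr rfl fun j _ => ?_
      rw [trigPoly, trigPoly, ← Finset.sum_sub_distrib]
      congr 3
      ext l
      rw [hst j l]
      ring
    have hmult : ∑ j ∈ J, ‖trigPoly (freqs L) a (q j)‖ ^ 2 ≤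
        4 * C * ∑ w ∈ W, ‖trigPoly (freqs L) a w‖ ^ 2 := by
      rw [← Finset.sum_fiberwise_of_maps_to (g := q) (t := W) (fun j hj => (hq j hj).1),
        Finset.mul_sum]
      refine Finset.sum_le_sum fun w _ => ?_
      have hc : ((J.filter fun j => q j = w).card : ℝ) ≤ 4 * C := by
        have h1 := card_mul_kL_le hL (J.filter fun j => q j = w) z (B := C * kL L)
          (fun a => (Finset.sum_le_sum_of_subset_of_nonneg (Finset.filter_subset _ _)
            fun _ _ _ => sq_nonneg _).trans (hup a)) w (by
            intro j hj
            rw [Finset.mem_filter] at hj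
            have h2 := (hq j hj.1).2
            rw [hj.2, dist_comm] at h2
            refine h2.le.trans ?_
            gcongr)
        rw [← mul_assoc] at h1
        exact le_of_mul_le_mul_right h1 hk
      calc ∑ j ∈ J.filter fun j => q j = w, ‖trigPoly (freqs L) a (q j)‖ ^ 2
          = ∑ j ∈ J.filter fun j => q j = w, ‖trigPoly (freqs L) a w‖ ^ 2 :=
            Finset.sum_congr rfl fun j hj => by rw [(Finset.mem_filter.1 hj).2]
        _ = ((J.filter fun j => q j = w).card : ℝ) * ‖trigPoly (freqs L) a w‖ ^ 2 := by
            rw [Finset.sum_const, nsmul_eq_mul]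
        _ ≤ _ := by gcongr
    have hsplit : ∑ j ∈ J, ‖trigPoly (freqs L) a (z j)‖ ^ 2 ≤
        2 * ∑ j ∈ J, ‖trigPoly (freqs L) a (q j) - trigPoly (freqs L) a (z j)‖ ^ 2 +
        2 * ∑ j ∈ J, ‖trigPoly (freqs L) a (q j)‖ ^ 2 := by
      rw [Finset.mul_sum, Finset.mul_sum, ← Finset.sum_add_distrib]
      refine Finset.sum_le_sum fun j _ => ?_
      have h := norm_sub_le (trigPoly (freqs L) a (q j))
        (trigPoly (freqs L) a (q j) - trigPoly (freqs L) a (z j))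
      rw [sub_sub_cancel] at h
      nlinarith [norm_nonneg (trigPoly (freqs L) a (z j)), sq_nonneg (‖trigPoly (freqs L) a (q j)‖ -
        ‖trigPoly (freqs L) a (q j) - trigPoly (freqs L) a (z j)‖)]
    have hA0 : 0 ≤ A := Finset.sum_nonneg fun _ _ => sq_nonneg _
    have hlow' := hlow a
    have hCe : (20 * C * ε) ^ 2 ≤ 1 := pow_le_one₀ (by positivity) hεC
    set T : ℝ := ∑ w ∈ W, ‖trigPoly (freqs L) a w‖ ^ 2
    have h1 : (kL L : ℝ) * A ≤ C * (2 * (88 * ε ^ 2 * (C * kL L) * A) + 2 * (4 * C * T)) := by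
      refine hlow'.trans ?_
      gcongr
      linarith
    have h2 : (20 * C * ε) ^ 2 * ((kL L : ℝ) * A) ≤ 1 * ((kL L : ℝ) * A) := by gcongr
    nlinarith [mul_nonneg hk.le hA0]

/-! ### Off-diagonal decay of the reproducing kernel -/

lemma mem_freqs_of_abs_le {L : ℝ} {n k m : ℤ} (h : (n, m) ∈ freqs L) (hk : |k| ≤ |n|) :
    (k, m) ∈ freqs L := by
  rw [mem_freqs] at h ⊢
  refine le_trans ?_ h
  have h1 : (k : ℝ) ^ 2 ≤ (n : ℝ) ^ 2 := by exact_mod_cast sq_le_sq.2 hk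
  simp only
  gcongr

lemma swap_mem_freqs {L : ℝ} {l : ℤ × ℤ} : l.swap ∈ freqs L ↔ l ∈ freqs L := by
  simp only [mem_freqs, Prod.fst_swap, Prod.snd_swap, add_comm]

lemma add_mem_freqs_of_emod_eq {L : ℝ} {n n' m t : ℤ} (ht : t ≠ 0) (h : (n, m) ∈ freqs L)
    (h' : (n', m) ∈ freqs L) (hmod : n % t = n' % t) (hne : n ≠ n') :
    (n + t, m) ∈ freqs L ∨ (n' + t, m) ∈ freqs L := by
  obtain ⟨c, hc⟩ := Int.ModEq.dvd hmod
  have hn' : n' = n + t * c := by linarith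
  have hc0 : c ≠ 0 := by
    rintro rfl
    exact hne (by linarith)
  have key : ∀ k : ℤ, (n ≤ k ∧ k ≤ n') ∨ (n' ≤ k ∧ k ≤ n) → (k, m) ∈ freqs L := by
    rintro k (⟨h1, h2⟩ | ⟨h1, h2⟩)
    · rcases le_max_iff.1 (abs_le_max_abs_abs h1 h2) with h3 | h3
      · exact mem_freqs_of_abs_le h h3
      · exact mem_freqs_of_abs_le h' h3
    · rcases le_max_iff.1 (abs_le_max_abs_abs h1 h2) with h3 | h3
      · exact mem_freqs_of_abs_le h' h3
      · exact mem_freqs_of_abs_le h h3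
  rcases lt_or_gt_of_ne hc0 with h1 | h1 <;> rcases lt_or_gt_of_ne ht with h2 | h2
  · exact Or.inr (key _ (Or.inl ⟨by nlinarith, by linarith⟩))
  · exact Or.inr (key _ (Or.inr ⟨by linarith, by nlinarith⟩))
  · exact Or.inl (key _ (Or.inr ⟨by nlinarith, by linarith⟩))
  · exact Or.inl (key _ (Or.inl ⟨by linarith, by nlinarith⟩))

lemma card_filter_shift_fst_le {L : ℝ} (hL : 1 ≤ L) {t : ℤ} (ht : t ≠ 0) :
    (((freqs L).filter fun l => l + (t, 0) ∉ freqs L).card : ℝ) ≤ 3 * L * |(t : ℝ)| := by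
  have hmaps : Set.MapsTo (fun l : ℤ × ℤ => (l.1 % t, l.2))
      ((freqs L).filter fun l => l + (t, 0) ∉ freqs L)
      ((Finset.Ico 0 |t|) ×ˢ (Finset.Icc (-⌊L⌋) ⌊L⌋) : Finset (ℤ × ℤ)) := by
    intro l hl
    have hl := (Finset.mem_filter.1 (Finset.mem_coe.1 hl)).1
    have h2 := (abs_freq_le (by linarith) hl).2
    simp only [Finset.coe_product, Set.mem_prod, Finset.coe_Ico, Finset.coe_Icc, Set.mem_Ico,
      Set.mem_Icc]
    refine ⟨⟨Int.emod_nonneg _ ht, Int.emod_lt_abs _ ht⟩, ?_⟩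
    rw [← abs_le, Int.le_floor]
    push_cast
    have hpi := Real.pi_gt_three
    rw [abs_mul, abs_of_pos (by positivity : (0 : ℝ) < 2 * Real.pi)] at h2
    nlinarith [abs_nonneg (l.2 : ℝ)]
  have hinj : Set.InjOn (fun l : ℤ × ℤ => (l.1 % t, l.2))
      ((freqs L).filter fun l => l + (t, 0) ∉ freqs L) := by
    rintro ⟨n, m⟩ hl ⟨n', m'⟩ hl' heq
    simp only [Finset.coe_filter, Set.mem_ofPred_eq, Prod.mk_add_mk, add_zero] at hl hl'
    simp only [Prod.mk.injEq] at heq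
    obtain ⟨h1, rfl⟩ := heq
    by_contra hne
    rcases add_mem_freqs_of_emod_eq ht hl.1 hl'.1 h1 (fun h => hne (by rw [h])) with h | h
    · exact hl.2 h
    · exact hl'.2 h
  have hcard := Finset.card_le_card_of_injOn _ hmaps hinj
  rw [Finset.card_product, Int.card_Ico, Int.card_Icc] at hcard
  have hfl : 0 ≤ ⌊L⌋ := Int.floor_nonneg.2 (by linarith)
  have hcast : (((freqs L).filter fun l => l + (t, 0) ∉ freqs L).card : ℝ) ≤
      |(t : ℝ)| * (2 * (⌊L⌋ : ℝ) + 1) := by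
    have h1 : (((freqs L).filter fun l => l + (t, 0) ∉ freqs L).card : ℤ) ≤
        |t| * (2 * ⌊L⌋ + 1) := by
      calc (((freqs L).filter fun l => l + (t, 0) ∉ freqs L).card : ℤ)
          ≤ (((|t| - 0).toNat * (⌊L⌋ + 1 - -⌊L⌋).toNat : ℕ) : ℤ) := by exact_mod_cast hcard
        _ = |t| * (2 * ⌊L⌋ + 1) := by
            rw [sub_zero, Nat.cast_mul, Int.toNat_of_nonneg (abs_nonneg t),
              Int.toNat_of_nonneg (by omega)]
            ring
    exact_mod_cast h1
  refine hcast.trans ?_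
  have := Int.floor_le L
  rw [mul_comm]
  gcongr
  linarith

lemma card_filter_shift_snd_le {L : ℝ} (hL : 1 ≤ L) {t : ℤ} (ht : t ≠ 0) :
    (((freqs L).filter fun l => l + (0, t) ∉ freqs L).card : ℝ) ≤ 3 * L * |(t : ℝ)| := by
  refine le_trans ?_ (card_filter_shift_fst_le hL ht)
  refine Nat.cast_le.2 (Finset.card_le_card_of_injOn Prod.swap ?_ Prod.swap_injective.injOn)
  intro l hl
  simp only [Finset.coe_filter, Set.mem_ofPred_eq] at hl ⊢
  refine ⟨swap_mem_freqs.2 hl.1, fun h => hl.2 ?_⟩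
  rw [← swap_mem_freqs]
  exact h

/-- Coefficients of the part of the kernel at `x` whose frequencies leave the spectrum
under the shift by `w`. -/
def edgeCoeff (L : ℝ) (x : T2) (w l : ℤ × ℤ) : ℂ :=
  if l + w ∈ freqs L then 0 else conj (ch l x)

lemma sum_norm_sq_edgeCoeff (L : ℝ) (x : T2) (w : ℤ × ℤ) :
    ∑ l ∈ freqs L, ‖edgeCoeff L x w l‖ ^ 2 =
      (((freqs L).filter fun l => l + w ∉ freqs L).card : ℝ) := by
  rw [Finset.card_filter, Nat.cast_sum]
  refine Finset.sum_congr rfl fun l _ => ?_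
  by_cases h : l + w ∈ freqs L <;> simp [edgeCoeff, h, norm_ch]

lemma repKer_eq_sum (L : ℝ) (x y : T2) : repKer L x y = ∑ l ∈ freqs L, ch l (x - y) := by
  simp only [repKer, trigPoly, ch_sub]
  exact Finset.sum_congr rfl fun l _ => mul_comm _ _

lemma trigPoly_edgeCoeff (L : ℝ) (x y : T2) (w : ℤ × ℤ) :
    trigPoly (freqs L) (edgeCoeff L x w) y =
      ∑ l ∈ (freqs L).filter fun l => l + w ∉ freqs L, ch l (y - x) := by
  rw [Finset.sum_filter, trigPoly]
  refine Finset.sum_congr rfl fun l _ => ?_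
  by_cases h : l + w ∈ freqs L
  · simp [edgeCoeff, h]
  · simp [edgeCoeff, h, ch_sub, mul_comm]

lemma ch_sub_one_mul_repKer (L : ℝ) (x y : T2) (w : ℤ × ℤ) :
    (ch w (y - x) - 1) * repKer L y x =
      ch w (y - x) * trigPoly (freqs L) (edgeCoeff L x w) y -
        trigPoly (freqs L) (edgeCoeff L x (-w)) y := by
  have h1 := Finset.sum_filter_add_sum_filter_not (freqs L) (fun l => l + w ∈ freqs L)
    fun l => ch l (y - x)
  have h2 := Finset.sum_filter_add_sum_filter_not (freqs L) (fun l => l + -w ∈ freqs L)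
    fun l => ch l (y - x)
  rw [← trigPoly_edgeCoeff, ← repKer_eq_sum] at h1 h2
  have h3 : ch w (y - x) * ∑ l ∈ (freqs L).filter fun l => l + w ∈ freqs L, ch l (y - x) =
      ∑ l ∈ (freqs L).filter fun l => l + -w ∈ freqs L, ch l (y - x) := by
    rw [Finset.mul_sum]
    refine Finset.sum_nbij' (fun l => l + w) (fun l => l + -w) ?_ ?_ ?_ ?_ ?_
    · intro l hl
      rw [Finset.mem_filter] at hl ⊢
      exact ⟨hl.2, by simpa using hl.1⟩
    · intro l hl
      rw [Finset.mem_filter] at hl ⊢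
      exact ⟨hl.2, by simpa using hl.1⟩
    · intro l _
      simp
    · intro l _
      simp
    · intro l _
      rw [ch_add_index, mul_comm]
  linear_combination (-ch w (y - x)) * h1 + h2 + h3

lemma norm_sq_ch_sub_one_mul_repKer_le (L : ℝ) (x y : T2) (w : ℤ × ℤ) :
    ‖ch w (y - x) - 1‖ ^ 2 * ‖repKer L y x‖ ^ 2 ≤
      2 * (‖trigPoly (freqs L) (edgeCoeff L x w) y‖ ^ 2 +
        ‖trigPoly (freqs L) (edgeCoeff L x (-w)) y‖ ^ 2) := by
  rw [← mul_pow, ← norm_mul, ch_sub_one_mul_repKer]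
  have h := norm_sub_le (ch w (y - x) * trigPoly (freqs L) (edgeCoeff L x w) y)
    (trigPoly (freqs L) (edgeCoeff L x (-w)) y)
  rw [norm_mul, norm_ch, one_mul] at h
  nlinarith [norm_nonneg (ch w (y - x) * trigPoly (freqs L) (edgeCoeff L x w) y -
    trigPoly (freqs L) (edgeCoeff L x (-w)) y),
    sq_nonneg (‖trigPoly (freqs L) (edgeCoeff L x w) y‖ -
      ‖trigPoly (freqs L) (edgeCoeff L x (-w)) y‖)]

lemma fourier_nat (n : ℕ) (s : AddCircle (1 : ℝ)) : fourier (n : ℤ) s = (fourier 1 s) ^ n := by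
  induction n with
  | zero => simp
  | succ n ih => rw [Nat.cast_succ, fourier_add, ih, pow_succ]

lemma four_mul_norm_le (s : AddCircle (1 : ℝ)) : 4 * ‖s‖ ≤ ‖fourier 1 s - 1‖ := by
  obtain ⟨r, rfl, hr⟩ := exists_real_rep s
  rw [← hr]
  have hhalf : |r| ≤ 1 / 2 := by
    rw [hr]
    simpa using AddCircle.norm_le_half_period (1 : ℝ) (x := (r : AddCircle (1 : ℝ))) one_ne_zero
  have h1 : fourier 1 (r : AddCircle (1 : ℝ)) = Complex.exp (Complex.I * ((2 * Real.pi * r : ℝ) : ℂ)) := by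
    rw [fourier_coe_apply]
    push_cast
    congr 1
    ring
  rw [h1, Complex.norm_exp_I_mul_ofReal_sub_one, norm_mul, Real.norm_eq_abs, Real.norm_eq_abs, abs_two]
  have h2 : |Real.sin (2 * Real.pi * r / 2)| = Real.sin (Real.pi * |r|) := by
    rw [show 2 * Real.pi * r / 2 = Real.pi * r by ring]
    have h3 : 0 ≤ Real.sin (Real.pi * |r|) := by
      refine Real.sin_nonneg_of_nonneg_of_le_pi (by positivity) ?_
      nlinarith [Real.pi_pos]
    rw [← abs_of_nonneg h3]
    rcases abs_choice r with h | h <;> rw [h]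
    rw [mul_neg, Real.sin_neg, abs_neg]
  rw [h2]
  have h4 := Real.mul_le_sin (x := Real.pi * |r|) (by positivity) (by nlinarith [Real.pi_pos])
  have h5 : 2 / Real.pi * (Real.pi * |r|) = 2 * |r| := by
    field_simp
  linarith

/-- Averaging over frequencies: a point away from `0` is moved by most characters. -/
lemma le_sum_norm_sq_fourier_sub_one (T : ℕ) (hT : 0 < T) (s : AddCircle (1 : ℝ))
    (hs : 1 / (T : ℝ) ≤ ‖s‖) :
    (T : ℝ) ≤ ∑ t ∈ Finset.range T, ‖fourier ((t : ℤ) + 1) s - 1‖ ^ 2 := by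
  set ζ : ℂ := fourier 1 s with hζ
  have hζ1 : ‖ζ‖ = 1 := by simp only [hζ, fourier_apply, Circle.norm_coe]
  have hT' : (0 : ℝ) < T := by exact_mod_cast hT
  have hterm : ∀ t : ℕ, ‖fourier ((t : ℤ) + 1) s - 1‖ ^ 2 = 2 - 2 * (ζ * ζ ^ t).re := by
    intro t
    have h1 : fourier ((t : ℤ) + 1) s = ζ * ζ ^ t := by
      rw [fourier_add, fourier_nat, mul_comm]
    have h2 : ‖ζ * ζ ^ t‖ = 1 := by rw [norm_mul, norm_pow, hζ1]; simp
    rw [h1, ← Complex.normSq_eq_norm_sq, Complex.normSq_sub, Complex.normSq_eq_norm_sq, h2]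
    simp
    ring
  simp_rw [hterm]
  rw [Finset.sum_sub_distrib, ← Finset.mul_sum, ← Complex.re_sum, ← Finset.mul_sum]
  simp only [Finset.sum_const, Finset.card_range, nsmul_eq_mul]
  have hgeom : ‖∑ t ∈ Finset.range T, ζ ^ t‖ * ‖ζ - 1‖ ≤ 2 := by
    rw [← norm_mul, geom_sum_mul]
    refine (norm_sub_le _ _).trans ?_
    rw [norm_pow, hζ1]
    norm_num
  have h4 := four_mul_norm_le s
  have hre := Complex.re_le_norm (ζ * ∑ t ∈ Finset.range T, ζ ^ t)
  rw [norm_mul, hζ1, one_mul] at hre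
  set G := ‖∑ t ∈ Finset.range T, ζ ^ t‖
  have hG : 0 ≤ G := norm_nonneg _
  have h5 : G * (4 * (1 / (T : ℝ))) ≤ 2 := by
    refine le_trans ?_ hgeom
    gcongr
    linarith
  have h6 : G * (4 * (1 / (T : ℝ))) = 4 * G / T := by ring
  rw [h6, div_le_iff₀ hT'] at h5
  linarith

/-- The kernel `K(·, x)` away from `x` is dominated by trigonometric polynomials with few
coefficients. -/
lemma exists_dominating_trigPoly {L ρ : ℝ} (hL : 1 ≤ L) (hρ : 0 < ρ) (hρ1 : ρ ≤ 1) (x : T2) :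
    ∃ (I : Finset (ℕ × ℤ × ℤ)) (a : ℕ × ℤ × ℤ → ℤ × ℤ → ℂ) (c : ℝ), 0 ≤ c ∧
      (∀ y, ρ ≤ dist y x →
        ‖repKer L y x‖ ^ 2 ≤ c * ∑ i ∈ I, ‖trigPoly (freqs L) (a i) y‖ ^ 2) ∧
      c * ∑ i ∈ I, ∑ l ∈ freqs L, ‖a i l‖ ^ 2 ≤ 48 * L / ρ := by
  set T : ℕ := ⌈1 / ρ⌉₊ with hTdef
  have hT : 0 < T := Nat.ceil_pos.2 (by positivity)
  have hT' : (0 : ℝ) < T := by exact_mod_cast hT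
  have hTρ : 1 / (T : ℝ) ≤ ρ := by
    rw [div_le_comm₀ hT' hρ]
    exact Nat.le_ceil _
  have hTle : (T : ℝ) ≤ 2 / ρ := by
    have h1 := (Nat.ceil_lt_add_one (by positivity : 0 ≤ 1 / ρ)).le
    have h2 : 1 ≤ 1 / ρ := by rwa [le_div_iff₀ hρ, one_mul]
    have h3 : 2 / ρ = 1 / ρ + 1 / ρ := by ring
    rw [← hTdef] at h1
    linarith
  let U : Finset (ℤ × ℤ) := {(1, 0), (-1, 0), (0, 1), (0, -1)}
  have hU : ∀ f : ℤ × ℤ → ℝ, ∑ u ∈ U, f u = f (1, 0) + (f (-1, 0) + (f (0, 1) + f (0, -1))) := by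
    intro f
    simp [U]
  let P : ℕ → ℤ × ℤ → T2 → ℝ := fun t u y =>
    ‖trigPoly (freqs L) (edgeCoeff L x (((t : ℤ) + 1) • u)) y‖ ^ 2
  refine ⟨Finset.range T ×ˢ U, fun i => edgeCoeff L x (((i.1 : ℤ) + 1) • i.2), 2 / T,
    by positivity, ?_, ?_⟩
  · intro y hy
    rw [Finset.sum_product, div_mul_eq_mul_div, le_div_iff₀ hT']
    change ‖repKer L y x‖ ^ 2 * T ≤ 2 * ∑ t ∈ Finset.range T, ∑ u ∈ U, P t u y
    have key : ∀ v : ℤ × ℤ, (∀ t : ℕ, P t v y + P t (-v) y ≤ ∑ u ∈ U, P t u y) →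
        (T : ℝ) ≤ ∑ t ∈ Finset.range T, ‖ch (((t : ℤ) + 1) • v) (y - x) - 1‖ ^ 2 →
        ‖repKer L y x‖ ^ 2 * T ≤ 2 * ∑ t ∈ Finset.range T, ∑ u ∈ U, P t u y := by
      intro v hv hTv
      calc ‖repKer L y x‖ ^ 2 * T
          ≤ ‖repKer L y x‖ ^ 2 *
              ∑ t ∈ Finset.range T, ‖ch (((t : ℤ) + 1) • v) (y - x) - 1‖ ^ 2 := by gcongr
        _ = ∑ t ∈ Finset.range T,
              ‖ch (((t : ℤ) + 1) • v) (y - x) - 1‖ ^ 2 * ‖repKer L y x‖ ^ 2 := by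
            rw [mul_comm, Finset.sum_mul]
        _ ≤ ∑ t ∈ Finset.range T, 2 * ∑ u ∈ U, P t u y := by
            refine Finset.sum_le_sum fun t _ => ?_
            refine (norm_sq_ch_sub_one_mul_repKer_le L x y _).trans ?_
            have := hv t
            simp only [P, smul_neg] at this ⊢
            linarith
        _ = _ := by rw [Finset.mul_sum]
    have hP : ∀ t u, 0 ≤ P t u y := fun t u => sq_nonneg _
    have hy' : ρ ≤ max ‖(y - x).1‖ ‖(y - x).2‖ := by
      rw [← Prod.norm_def, ← dist_eq_norm]
      exact hy
    rcases le_max_iff.1 hy' with h | h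
    · refine key (1, 0) (fun t => ?_) ?_
      · rw [hU, show -((1, 0) : ℤ × ℤ) = (-1, 0) by simp]
        linarith [hP t (0, 1), hP t (0, -1)]
      · refine (le_sum_norm_sq_fourier_sub_one T hT _ (hTρ.trans h)).trans (le_of_eq ?_)
        refine Finset.sum_congr rfl fun t _ => ?_
        simp [ch, eChar]
    · refine key (0, 1) (fun t => ?_) ?_
      · rw [hU, show -((0, 1) : ℤ × ℤ) = (0, -1) by simp]
        linarith [hP t (1, 0), hP t (-1, 0)]
      · refine (le_sum_norm_sq_fourier_sub_one T hT _ (hTρ.trans h)).trans (le_of_eq ?_)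
        refine Finset.sum_congr rfl fun t _ => ?_
        simp [ch, eChar]
  · have hcount : ∀ t ∈ Finset.range T, ∀ u ∈ U,
        ∑ l ∈ freqs L, ‖edgeCoeff L x (((t : ℤ) + 1) • u) l‖ ^ 2 ≤ 3 * L * T := by
      intro t ht u hu
      rw [sum_norm_sq_edgeCoeff]
      have h1 : ((t : ℝ) + 1) ≤ T := by exact_mod_cast Finset.mem_range.1 ht
      have h2 : |(((t : ℤ) + 1 : ℤ) : ℝ)| ≤ T := by
        push_cast
        rwa [abs_of_nonneg (by positivity)]
      have h3 : |((-((t : ℤ) + 1) : ℤ) : ℝ)| ≤ T := by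
        rw [Int.cast_neg, abs_neg]
        exact h2
      have h4 : (t : ℤ) + 1 ≠ 0 := by omega
      have h5 : -((t : ℤ) + 1) ≠ 0 := by omega
      simp only [U, Finset.mem_insert, Finset.mem_singleton] at hu
      rcases hu with rfl | rfl | rfl | rfl
      · simp only [Prod.smul_mk, smul_eq_mul, mul_one, mul_zero]
        exact (card_filter_shift_fst_le hL h4).trans (by gcongr)
      · simp only [Prod.smul_mk, smul_eq_mul, mul_neg, mul_one, mul_zero]
        exact (card_filter_shift_fst_le hL h5).trans (by gcongr)
      · simp only [Prod.smul_mk, smul_eq_mul, mul_one, mul_zero]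
        exact (card_filter_shift_snd_le hL h4).trans (by gcongr)
      · simp only [Prod.smul_mk, smul_eq_mul, mul_neg, mul_one, mul_zero]
        exact (card_filter_shift_snd_le hL h5).trans (by gcongr)
    calc 2 / (T : ℝ) * ∑ i ∈ Finset.range T ×ˢ U,
          ∑ l ∈ freqs L, ‖edgeCoeff L x (((i.1 : ℤ) + 1) • i.2) l‖ ^ 2
        ≤ 2 / (T : ℝ) * ∑ i ∈ Finset.range T ×ˢ U, 3 * L * T := by
          refine mul_le_mul_of_nonneg_left (Finset.sum_le_sum fun i hi => ?_) (by positivity)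
          rw [Finset.mem_product] at hi
          exact hcount _ hi.1 _ hi.2
      _ = 24 * L * T := by
          have hcU : U.card = 4 := by simp [U]
          rw [Finset.sum_const, Finset.card_product, Finset.card_range, hcU, nsmul_eq_mul]
          push_cast
          field_simp
          ring
      _ ≤ 24 * L * (2 / ρ) := by gcongr
      _ = _ := by ring

/-- Tail estimate for sums over a set of sampling points with a Bessel bound. -/
lemma sum_norm_sq_repKer_le {L ρ : ℝ} (hL : 1 ≤ L) (hρ : 0 < ρ) (hρ1 : ρ ≤ 1) (x : T2)
    (W : Finset T2) {B : ℝ} (hB0 : 0 ≤ B)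
    (hB : ∀ a, ∑ w ∈ W, ‖trigPoly (freqs L) a w‖ ^ 2 ≤ B * ∑ l ∈ freqs L, ‖a l‖ ^ 2)
    (hW : ∀ w ∈ W, ρ ≤ dist w x) : ∑ w ∈ W, ‖repKer L w x‖ ^ 2 ≤ B * (48 * L / ρ) := by
  obtain ⟨I, a, c, hc, hdom, hsum⟩ := exists_dominating_trigPoly hL hρ hρ1 x
  calc ∑ w ∈ W, ‖repKer L w x‖ ^ 2
      ≤ ∑ w ∈ W, c * ∑ i ∈ I, ‖trigPoly (freqs L) (a i) w‖ ^ 2 :=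
        Finset.sum_le_sum fun w hw => hdom w (hW w hw)
    _ = c * ∑ i ∈ I, ∑ w ∈ W, ‖trigPoly (freqs L) (a i) w‖ ^ 2 := by
        rw [← Finset.mul_sum, Finset.sum_comm]
    _ ≤ c * ∑ i ∈ I, B * ∑ l ∈ freqs L, ‖a i l‖ ^ 2 := by
        gcongr
        exact hB _
    _ = B * (c * ∑ i ∈ I, ∑ l ∈ freqs L, ‖a i l‖ ^ 2) := by
        rw [← Finset.mul_sum]
        ring
    _ ≤ _ := by gcongr

lemma continuous_norm_sq_trigPoly (S : Finset (ℤ × ℤ)) (a : ℤ × ℤ → ℂ) :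
    Continuous fun x => ‖trigPoly S a x‖ ^ 2 :=
  (continuous_trigPoly S a).norm.pow 2

/-- Tail estimate for the integral of the squared kernel. -/
lemma setIntegral_norm_sq_repKer_le {L ρ : ℝ} (hL : 1 ≤ L) (hρ : 0 < ρ) (hρ1 : ρ ≤ 1) (x : T2)
    {S : Set T2} (hS : MeasurableSet S) (h : ∀ y ∈ S, ρ ≤ dist y x) :
    ∫ y in S, ‖repKer L y x‖ ^ 2 ≤ 48 * L / ρ := by
  obtain ⟨I, a, c, hc, hdom, hsum⟩ := exists_dominating_trigPoly hL hρ hρ1 x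
  have hcont : Continuous fun y => c * ∑ i ∈ I, ‖trigPoly (freqs L) (a i) y‖ ^ 2 :=
    continuous_const.mul (continuous_finsetSum _ fun i _ => continuous_norm_sq_trigPoly _ _)
  calc ∫ y in S, ‖repKer L y x‖ ^ 2
      ≤ ∫ y in S, c * ∑ i ∈ I, ‖trigPoly (freqs L) (a i) y‖ ^ 2 :=
        setIntegral_mono_on
          (integrable_real_of_continuous (continuous_norm_sq_trigPoly _ _)).integrableOn
          (integrable_real_of_continuous hcont).integrableOn hS fun y hy => hdom y (h y hy)
    _ ≤ ∫ y, c * ∑ i ∈ I, ‖trigPoly (freqs L) (a i) y‖ ^ 2 :=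
        setIntegral_le_integral (integrable_real_of_continuous hcont)
          (ae_of_all _ fun y => mul_nonneg hc (Finset.sum_nonneg fun _ _ => sq_nonneg _))
    _ = c * ∑ i ∈ I, ∑ l ∈ freqs L, ‖a i l‖ ^ 2 := by
        rw [integral_const_mul, integral_finsetSum _ fun i _ =>
          integrable_real_of_continuous (continuous_norm_sq_trigPoly _ _)]
        simp_rw [integral_norm_sq_trigPoly]
    _ ≤ _ := hsum

lemma repKer_self (L : ℝ) (x : T2) : repKer L x x = kL L := by
  rw [repKer_eq_sum, sub_self, kL_eq_card]
  simp [ch_zero_arg]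

lemma repKer_symm (L : ℝ) (x y : T2) : repKer L y x = conj (repKer L x y) := by
  rw [repKer_eq_sum, repKer_eq_sum, map_sum]
  refine Finset.sum_congr rfl fun l _ => ?_
  rw [← neg_sub x y, ch_neg]

lemma integral_mul_conj_repKer (L : ℝ) (a : ℤ × ℤ → ℂ) (y : T2) :
    ∫ x, trigPoly (freqs L) a x * conj (repKer L x y) = trigPoly (freqs L) a y := by
  unfold repKer
  rw [integral_trigPoly_mul_conj]
  simp [trigPoly]

lemma integral_norm_sq_repKer (L : ℝ) (y : T2) : ∫ x, ‖repKer L x y‖ ^ 2 = kL L := by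
  unfold repKer
  rw [integral_norm_sq_trigPoly, sum_norm_sq_conj_ch, kL_eq_card]

/-! ### The dual kernel of a sampling set -/

/-- A set of points with a lower sampling bound admits a Hermitian reconstruction kernel. -/
lemma exists_dual_kernel (L : ℝ) (W : Finset T2) {C : ℝ}
    (hlow : ∀ a, (kL L : ℝ) * ∑ l ∈ freqs L, ‖a l‖ ^ 2 ≤
      C * ∑ w ∈ W, ‖trigPoly (freqs L) a w‖ ^ 2) :
    ∃ H : T2 → T2 → ℂ, (∀ y, ∃ a, ∀ x, H x y = trigPoly (freqs L) a x) ∧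
      (∀ x y, H y x = conj (H x y)) ∧
      ∀ a x, trigPoly (freqs L) a x = ∑ w ∈ W, trigPoly (freqs L) a w * H x w := by
  let Φ : EL L →ₗ[ℂ] EuclideanSpace ℂ W :=
    { toFun := fun f => WithLp.toLp 2 fun w => (f : T2 → ℂ) w
      map_add' := fun f g => rfl
      map_smul' := fun c f => rfl }
  have hker : ∀ f : EL L, Φ f = 0 → f = 0 := by
    intro f hf
    obtain ⟨a, ha⟩ := mem_EL_iff.1 f.2
    have hW : ∀ w ∈ W, trigPoly (freqs L) a w = 0 := fun w hw => by
      rw [← ha]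
      exact congrArg (fun v : EuclideanSpace ℂ W => v ⟨w, hw⟩) hf
    have h1 := hlow a
    have h0 : ∑ w ∈ W, ‖trigPoly (freqs L) a w‖ ^ 2 = 0 :=
      Finset.sum_eq_zero fun w hw => by rw [hW w hw]; simp
    rw [h0, mul_zero] at h1
    have h2 : ∑ l ∈ freqs L, ‖a l‖ ^ 2 ≤ 0 := nonpos_of_mul_nonpos_right h1 (kL_pos L)
    have h3 := (Finset.sum_eq_zero_iff_of_nonneg (fun l _ => sq_nonneg ‖a l‖)).1
      (le_antisymm h2 (Finset.sum_nonneg fun _ _ => sq_nonneg _))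
    ext x
    rw [ha]
    refine Finset.sum_eq_zero fun l hl => ?_
    have h4 : a l = 0 := by simpa using h3 l hl
    rw [h4, zero_mul]
  let b := stdOrthonormalBasis ℂ (LinearMap.range Φ)
  choose u hu using fun i => (b i).2
  have hcoef : ∀ (f : EL L) i, inner ℂ (b i) (Φ.rangeRestrict f) =
      ∑ w ∈ W, (f : T2 → ℂ) w * conj ((u i : T2 → ℂ) w) := by
    intro f i
    rw [Submodule.coe_inner, ← hu i, PiLp.inner_apply,
      ← Finset.sum_coe_sort W (fun w => (f : T2 → ℂ) w * conj ((u i : T2 → ℂ) w))]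
    rfl
  refine ⟨fun x y => ∑ i, (u i : T2 → ℂ) x * conj ((u i : T2 → ℂ) y), fun y => ?_,
    fun x y => ?_, fun a x => ?_⟩
  · have hmem : (∑ i, conj ((u i : T2 → ℂ) y) • (u i : T2 → ℂ)) ∈ EL L :=
      Submodule.sum_mem _ fun i _ => Submodule.smul_mem _ _ (u i).2
    obtain ⟨a, ha⟩ := mem_EL_iff.1 hmem
    refine ⟨a, fun x => ?_⟩
    rw [← ha]
    simp [mul_comm]
  · simp [mul_comm]
  · let f : EL L := ⟨trigPoly (freqs L) a, mem_EL_iff.2 ⟨a, rfl⟩⟩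
    have hf : f = ∑ i, inner ℂ (b i) (Φ.rangeRestrict f) • u i := by
      rw [← sub_eq_zero]
      apply hker
      rw [map_sub, sub_eq_zero, map_sum]
      have h1 := congrArg (fun v : LinearMap.range Φ => (v : EuclideanSpace ℂ W))
        (b.sum_repr' (Φ.rangeRestrict f))
      simp only [Submodule.coe_sum, Submodule.coe_smul] at h1
      refine (show Φ f = _ from h1.symm).trans ?_
      exact Finset.sum_congr rfl fun i _ => by rw [map_smul, hu]
    have hfx := congrArg (fun g : EL L => (g : T2 → ℂ) x) hf
    simp only [Submodule.coe_sum, Submodule.coe_smul, Finset.sum_apply, Pi.smul_apply,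
      smul_eq_mul, hcoef] at hfx
    change trigPoly (freqs L) a x = _ at hfx
    rw [hfx]
    simp_rw [Finset.mul_sum, Finset.sum_mul]
    rw [Finset.sum_comm]
    refine Finset.sum_congr rfl fun w _ => Finset.sum_congr rfl fun i _ => ?_
    change trigPoly (freqs L) a w * _ * _ = _
    ring

lemma norm_sq_trigPoly_le (S : Finset (ℤ × ℤ)) (a : ℤ × ℤ → ℂ) (x : T2) :
    ‖trigPoly S a x‖ ^ 2 ≤ S.card * ∑ l ∈ S, ‖a l‖ ^ 2 := by
  have h1 : ‖trigPoly S a x‖ ≤ ∑ l ∈ S, ‖a l‖ :=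
    norm_sum_le_of_le _ fun l _ => by rw [norm_mul, norm_ch, mul_one]
  calc ‖trigPoly S a x‖ ^ 2 ≤ (∑ l ∈ S, ‖a l‖) ^ 2 := by gcongr
    _ ≤ _ := sq_sum_le_card_mul_sum_sq

/-- Quantitative properties of the reconstruction kernel. -/
lemma exists_dual_kernel_bounds (L : ℝ) (W : Finset T2) {C : ℝ} (hC : 0 < C)
    (hlow : ∀ a, (kL L : ℝ) * ∑ l ∈ freqs L, ‖a l‖ ^ 2 ≤
      C * ∑ w ∈ W, ‖trigPoly (freqs L) a w‖ ^ 2) :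
    ∃ H : T2 → T2 → ℂ, (∀ y, ∃ a, ∀ x, H x y = trigPoly (freqs L) a x) ∧
      (∀ a x, trigPoly (freqs L) a x = ∑ w ∈ W, trigPoly (freqs L) a w * H x w) ∧
      (∀ w ∈ W, (H w w).re ≤ 1) ∧ (∀ x, ∑ w ∈ W, ‖H x w‖ ^ 2 ≤ C) ∧
      ∀ y, (kL L : ℝ) * ∫ x, ‖H x y‖ ^ 2 ≤ C ^ 2 := by
  obtain ⟨H, hE, hsymm, hrec⟩ := exists_dual_kernel L W hlow
  have hk := kL_pos L
  have hdiag : ∀ x, H x x = ((∑ w ∈ W, ‖H x w‖ ^ 2 : ℝ) : ℂ) := by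
    intro x
    obtain ⟨a, ha⟩ := hE x
    have h1 := hrec a x
    simp_rw [← ha] at h1
    rw [h1, Complex.ofReal_sum]
    refine Finset.sum_congr rfl fun w _ => ?_
    rw [hsymm x w, mul_comm, Complex.mul_conj, Complex.normSq_eq_norm_sq]
  have hdiag' : ∀ x, ‖H x x‖ = ∑ w ∈ W, ‖H x w‖ ^ 2 := fun x => by
    rw [hdiag, Complex.norm_real, Real.norm_of_nonneg (Finset.sum_nonneg fun _ _ => sq_nonneg _)]
  have hcoef : ∀ y a, (∀ x, H x y = trigPoly (freqs L) a x) →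
      (kL L : ℝ) * ∑ l ∈ freqs L, ‖a l‖ ^ 2 ≤ C * ∑ w ∈ W, ‖H y w‖ ^ 2 := by
    intro y a ha
    refine (hlow a).trans (le_of_eq ?_)
    congr 1
    refine Finset.sum_congr rfl fun w _ => ?_
    rw [← ha, hsymm y w, RCLike.norm_conj]
  have hbd : ∀ x, ∑ w ∈ W, ‖H x w‖ ^ 2 ≤ C := by
    intro x
    obtain ⟨a, ha⟩ := hE x
    have h1 := norm_sq_trigPoly_le (freqs L) a x
    rw [← ha, hdiag', ← kL_eq_card] at h1
    have h2 := h1.trans (hcoef x a ha)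
    have h3 : 0 ≤ ∑ w ∈ W, ‖H x w‖ ^ 2 := Finset.sum_nonneg fun _ _ => sq_nonneg _
    nlinarith
  refine ⟨H, hE, hrec, fun w hw => ?_, hbd, fun y => ?_⟩
  · have h1 : ‖H w w‖ ^ 2 ≤ ‖H w w‖ := by
      rw [hdiag' w]
      conv_lhs => rw [← hdiag' w]
      exact Finset.single_le_sum (f := fun v => ‖H w v‖ ^ 2) (fun _ _ => sq_nonneg _) hw
    have h2 := Complex.re_le_norm (H w w)
    nlinarith [norm_nonneg (H w w)]
  · obtain ⟨a, ha⟩ := hE y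
    simp_rw [ha]
    rw [integral_norm_sq_trigPoly]
    refine (hcoef y a ha).trans ?_
    rw [sq]
    gcongr
    exact hbd y

/-! ### Local density inequality -/

lemma abs_re_mul_le {α : ℝ} (hα : 0 < α) (u v : ℂ) :
    |(u * v).re| ≤ (α * ‖u‖ ^ 2 + ‖v‖ ^ 2 / α) / 2 := by
  have h1 : |(u * v).re| ≤ ‖u‖ * ‖v‖ := by
    rw [← norm_mul]
    exact Complex.abs_re_le_norm _
  have h2 : α * ‖u‖ ^ 2 + ‖v‖ ^ 2 / α - 2 * (‖u‖ * ‖v‖) = (α * ‖u‖ - ‖v‖) ^ 2 / α := by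
    field_simp
    ring
  have h3 : 0 ≤ (α * ‖u‖ - ‖v‖) ^ 2 / α := by positivity
  linarith

/-- Integrals of products of kernels, controlled by their square integrals. -/
lemma abs_setIntegral_re_mul_le {u v : T2 → ℂ} (hu : Continuous u) (hv : Continuous v)
    {α : ℝ} (hα : 0 < α) (S : Set T2) :
    |∫ x in S, (u x * v x).re| ≤
      (α * ∫ x in S, ‖u x‖ ^ 2) / 2 + (∫ x, ‖v x‖ ^ 2) / α / 2 := by
  have hiu : Integrable fun x => ‖u x‖ ^ 2 := integrable_real_of_continuous (hu.norm.pow 2)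
  have hiv : Integrable fun x => ‖v x‖ ^ 2 := integrable_real_of_continuous (hv.norm.pow 2)
  have hiuv : Integrable fun x => |(u x * v x).re| :=
    integrable_real_of_continuous (Complex.continuous_re.comp (hu.mul hv)).abs
  calc |∫ x in S, (u x * v x).re| ≤ ∫ x in S, |(u x * v x).re| := abs_integral_le_integral_abs
    _ ≤ ∫ x in S, (α / 2 * ‖u x‖ ^ 2 + 1 / (2 * α) * ‖v x‖ ^ 2) := by
        refine integral_mono hiuv.integrableOn
          ((hiu.const_mul _).add (hiv.const_mul _)).integrableOn fun x => ?_
        refine (abs_re_mul_le hα (u x) (v x)).trans (le_of_eq ?_)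
        field_simp
    _ = α / 2 * (∫ x in S, ‖u x‖ ^ 2) + 1 / (2 * α) * ∫ x in S, ‖v x‖ ^ 2 := by
        rw [integral_add (hiu.const_mul _).integrableOn (hiv.const_mul _).integrableOn,
          integral_const_mul, integral_const_mul]
    _ ≤ α / 2 * (∫ x in S, ‖u x‖ ^ 2) + 1 / (2 * α) * ∫ x, ‖v x‖ ^ 2 := by
        have := setIntegral_le_integral (s := S) hiv (ae_of_all _ fun _ => sq_nonneg _)
        gcongr
    _ = _ := by
        field_simp

lemma local_density_inequality {L ρ σ C D : ℝ} (hL : 1 ≤ L) (hρ : 0 < ρ) (hρ1 : ρ ≤ 1)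
    (hσ : 0 < σ) (hσρ : 48 * L / ρ ≤ σ ^ 2 * kL L) (W : Finset T2) (hC : 0 < C) (hD : 0 < D)
    (hup : ∀ a, ∑ w ∈ W, ‖trigPoly (freqs L) a w‖ ^ 2 ≤
      D * kL L * ∑ l ∈ freqs L, ‖a l‖ ^ 2)
    (hlow : ∀ a, (kL L : ℝ) * ∑ l ∈ freqs L, ‖a l‖ ^ 2 ≤
      C * ∑ w ∈ W, ‖trigPoly (freqs L) a w‖ ^ 2)
    {B : Set T2} (hB : MeasurableSet B) (I A : Finset T2) (hI : I ⊆ W) (hA : A ⊆ W \ I)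
    (hIB : ∀ w ∈ I, ∀ x ∉ B, ρ ≤ dist x w)
    (hAB : ∀ w ∈ (W \ I) \ A, ∀ x ∈ B, ρ ≤ dist w x) :
    (kL L : ℝ) * volume.real B ≤ I.card * (1 + σ * (1 + C ^ 2) / 2) + A.card * ((1 + C ^ 2) / 2) +
      volume.real B * ((kL L : ℝ) * (σ * (C + D) / 2)) := by
  obtain ⟨H, hE, hrec, hdiag, hsum, hHnorm⟩ := exists_dual_kernel_bounds L W hC hlow
  have hk := kL_pos L
  set k : ℝ := (kL L : ℝ) with hkdef
  have hK : ∀ y, Continuous fun x => repKer L x y := fun y => continuous_trigPoly _ _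
  have hH : ∀ y, Continuous fun x => H x y := fun y => by
    obtain ⟨a, ha⟩ := hE y
    simp_rw [ha]
    exact continuous_trigPoly _ _
  have hK' : ∀ w, Continuous fun x => repKer L w x := fun w => by
    simp_rw [fun x => repKer_symm L x w]
    exact Complex.continuous_conj.comp (hK w)
  have hKn : ∀ w x, ‖repKer L w x‖ = ‖repKer L x w‖ := fun w x => by
    rw [repKer_symm L x w, RCLike.norm_conj]
  let g : T2 → T2 → ℝ := fun w x => (repKer L w x * H x w).re
  have hg : ∀ w, Integrable (g w) := fun w =>
    integrable_real_of_continuous (Complex.continuous_re.comp ((hK' w).mul (hH w)))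
  have hpt : ∀ x, k = ∑ w ∈ W, g w x := by
    intro x
    have h1 : repKer L x x = ∑ w ∈ W, repKer L w x * H x w := hrec _ x
    rw [repKer_self] at h1
    have h2 := congrArg Complex.re h1
    rw [Complex.re_sum] at h2
    exact h2
  have hHi : ∀ w, ∫ x, ‖H x w‖ ^ 2 ≤ C ^ 2 / k := fun w => by
    rw [le_div_iff₀ hk, mul_comm]
    exact hHnorm w
  have hinner : ∀ w ∈ I, ∫ x in B, g w x ≤ 1 + σ * (1 + C ^ 2) / 2 := by
    intro w hw
    have h1 : ∫ x in B, g w x = (∫ x, g w x) - ∫ x in Bᶜ, g w x := by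
      rw [← integral_add_compl hB (hg w)]
      ring
    have h2 : ∫ x, g w x = (H w w).re := by
      obtain ⟨a, ha⟩ := hE w
      have h3 := integral_mul_conj_repKer L a w
      simp_rw [← ha, ← repKer_symm L _ w] at h3
      rw [← h3]
      have h4 := integral_re (𝕜 := ℂ) (μ := volume) (f := fun x => H x w * repKer L w x)
        (integrable_of_continuous ((hH w).mul (hK' w)))
      simp only [RCLike.re_to_complex] at h4
      rw [← h4]
      exact integral_congr_ae (ae_of_all _ fun x => by simp only [g, mul_comm])
    have h5 := abs_setIntegral_re_mul_le (hK' w) (hH w) (α := 1 / (k * σ)) (by positivity) Bᶜ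
    have h6 : ∫ x in Bᶜ, ‖repKer L w x‖ ^ 2 ≤ σ ^ 2 * k := by
      simp_rw [hKn w]
      exact (setIntegral_norm_sq_repKer_le hL hρ hρ1 w hB.compl fun y hy => hIB w hw y hy).trans
        hσρ
    have h7 : 1 / (k * σ) * ∫ x in Bᶜ, ‖repKer L w x‖ ^ 2 ≤ σ := by
      calc _ ≤ 1 / (k * σ) * (σ ^ 2 * k) := by gcongr
        _ = σ := by field_simp
    have h8 : (∫ x, ‖H x w‖ ^ 2) / (1 / (k * σ)) ≤ σ * C ^ 2 := by
      calc _ ≤ C ^ 2 / k / (1 / (k * σ)) := by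
            gcongr
            exact hHi w
        _ = σ * C ^ 2 := by field_simp
    have h9 := neg_abs_le (∫ x in Bᶜ, g w x)
    have h10 := hdiag w (hI hw)
    rw [h1, h2]
    change |∫ x in Bᶜ, g w x| ≤ _ at h5
    linarith
  have hann : ∀ w ∈ A, ∫ x in B, g w x ≤ (1 + C ^ 2) / 2 := by
    intro w _
    have h5 := abs_setIntegral_re_mul_le (hK' w) (hH w) (α := 1 / k) (by positivity) B
    have h6 : ∫ x in B, ‖repKer L w x‖ ^ 2 ≤ k := by
      simp_rw [hKn w]
      exact (setIntegral_le_integral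
        (integrable_real_of_continuous (continuous_norm_sq_trigPoly _ _))
        (ae_of_all _ fun _ => sq_nonneg _)).trans (integral_norm_sq_repKer L w).le
    have h7 : 1 / k * ∫ x in B, ‖repKer L w x‖ ^ 2 ≤ 1 := by
      calc _ ≤ 1 / k * k := by gcongr
        _ = 1 := by field_simp
    have h8 : (∫ x, ‖H x w‖ ^ 2) / (1 / k) ≤ C ^ 2 := by
      calc _ ≤ C ^ 2 / k / (1 / k) := by
            gcongr
            exact hHi w
        _ = C ^ 2 := by field_simp
    have h9 := le_abs_self (∫ x in B, g w x)
    change |∫ x in B, g w x| ≤ _ at h5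
    linarith
  have hout : ∀ x ∈ B, ∑ w ∈ (W \ I) \ A, g w x ≤ k * (σ * (C + D) / 2) := by
    intro x hx
    have hsub : (W \ I) \ A ⊆ W := Finset.sdiff_subset.trans Finset.sdiff_subset
    have h1 : ∑ w ∈ (W \ I) \ A, ‖repKer L w x‖ ^ 2 ≤ D * k * (σ ^ 2 * k) := by
      refine (sum_norm_sq_repKer_le hL hρ hρ1 x _ (B := D * k) (by positivity) (fun a => ?_)
        fun w hw => hAB w hw x hx).trans ?_
      · exact (Finset.sum_le_sum_of_subset_of_nonneg hsub fun _ _ _ => sq_nonneg _).trans (hup a)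
      · gcongr
    have h2 : ∑ w ∈ (W \ I) \ A, ‖H x w‖ ^ 2 ≤ C :=
      (Finset.sum_le_sum_of_subset_of_nonneg hsub fun _ _ _ => sq_nonneg _).trans (hsum x)
    calc ∑ w ∈ (W \ I) \ A, g w x
        ≤ ∑ w ∈ (W \ I) \ A,
          (1 / (k * σ) * ‖repKer L w x‖ ^ 2 + ‖H x w‖ ^ 2 / (1 / (k * σ))) / 2 :=
          Finset.sum_le_sum fun w _ => (le_abs_self _).trans (abs_re_mul_le (by positivity) _ _)
      _ = (1 / (k * σ) * ∑ w ∈ (W \ I) \ A, ‖repKer L w x‖ ^ 2 +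
            (∑ w ∈ (W \ I) \ A, ‖H x w‖ ^ 2) / (1 / (k * σ))) / 2 := by
          rw [← Finset.sum_div, Finset.sum_add_distrib, Finset.mul_sum, Finset.sum_div]
      _ ≤ (1 / (k * σ) * (D * k * (σ ^ 2 * k)) + C / (1 / (k * σ))) / 2 := by gcongr
      _ = _ := by
          field_simp
          ring
  have hconst : k * volume.real B = ∫ x in B, ∑ w ∈ W, g w x := by
    simp_rw [← hpt]
    rw [setIntegral_const, smul_eq_mul, mul_comm]
  have hsplit : ∀ x, ∑ w ∈ W, g w x =
      ∑ w ∈ I, g w x + (∑ w ∈ A, g w x + ∑ w ∈ (W \ I) \ A, g w x) := by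
    intro x
    rw [add_comm (∑ w ∈ A, g w x), Finset.sum_sdiff hA, add_comm, Finset.sum_sdiff hI]
  have hi : ∀ S : Finset T2, IntegrableOn (fun x => ∑ w ∈ S, g w x) B := fun S =>
    (integrable_finsetSum _ fun w _ => hg w).integrableOn
  rw [hconst]
  simp_rw [hsplit]
  have hadd := integral_add (hi I) ((hi A).add (hi ((W \ I) \ A)))
  simp only [Pi.add_apply] at hadd
  rw [hadd, integral_add (hi A) (hi _),
    integral_finsetSum _ fun w _ => (hg w).integrableOn,
    integral_finsetSum _ fun w _ => (hg w).integrableOn, ← add_assoc]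
  gcongr ?_ + ?_ + ?_
  · refine (Finset.sum_le_sum hinner).trans (le_of_eq ?_)
    rw [Finset.sum_const, nsmul_eq_mul]
  · refine (Finset.sum_le_sum hann).trans (le_of_eq ?_)
    rw [Finset.sum_const, nsmul_eq_mul]
  · calc ∫ x in B, ∑ w ∈ (W \ I) \ A, g w x ≤ ∫ x in B, k * (σ * (C + D) / 2) :=
          setIntegral_mono_on (hi _) (integrable_const _).integrableOn hB hout
      _ = _ := by rw [setIntegral_const, smul_eq_mul]

/-! ### Volumes and counting -/

lemma volume_real_ball {ξ : T2} {r : ℝ} (hr0 : 0 ≤ r) (hr : r ≤ 1 / 2) :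
    volume.real (Metric.ball ξ r) = 4 * r ^ 2 := by
  have h1 : ∀ x : AddCircle (1 : ℝ), volume (Metric.ball x r) = ENNReal.ofReal (2 * r) := by
    intro x
    rw [← measure_congr (AddCircle.closedBall_ae_eq_ball (x := x) (ε := r)),
      AddCircle.volume_closedBall, min_eq_right (by linarith)]
  rw [measureReal_def, ← ball_prod_same, Measure.volume_eq_prod, Measure.prod_prod, h1, h1,
    ENNReal.toReal_mul, ENNReal.toReal_ofReal (by linarith)]
  ring

/-- Volume packing bound for separated points. -/
lemma card_mul_sq_le_volume {δ : ℝ} (hδ : 0 < δ) (hδ1 : δ ≤ 1) (S : Finset T2)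
    (hS : ∀ p ∈ S, ∀ q ∈ S, p ≠ q → δ ≤ dist p q) {U : Set T2}
    (hU : ∀ p ∈ S, Metric.ball p (δ / 2) ⊆ U) : S.card * δ ^ 2 ≤ volume.real U := by
  have hdisj : Set.PairwiseDisjoint (S : Set T2) fun p => Metric.ball p (δ / 2) :=
    fun p hp q hq hpq => Metric.ball_disjoint_ball (by linarith [hS p hp q hq hpq])
  have h1 := measureReal_biUnion_finset (μ := (volume : Measure T2)) hdisj
    fun p _ => Metric.isOpen_ball.measurableSet
  have h2 : volume.real (⋃ p ∈ S, Metric.ball p (δ / 2)) = S.card * δ ^ 2 := by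
    rw [h1, Finset.sum_congr rfl fun p _ => volume_real_ball (by linarith) (by linarith),
      Finset.sum_const, nsmul_eq_mul]
    ring
  rw [← h2]
  exact measureReal_mono (Set.iUnion₂_subset hU)

lemma card_mul_sq_le_of_ball {δ b : ℝ} (hδ : 0 < δ) (hb : 0 ≤ b) (hδb : b + δ / 2 ≤ 1 / 2)
    (S : Finset T2) (hS : ∀ p ∈ S, ∀ q ∈ S, p ≠ q → δ ≤ dist p q) (ξ : T2)
    (h : ∀ p ∈ S, dist p ξ < b) : S.card * δ ^ 2 ≤ 4 * (b + δ / 2) ^ 2 := by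
  rw [← volume_real_ball (ξ := ξ) (by linarith) hδb]
  refine card_mul_sq_le_volume hδ (by linarith) S hS fun p hp => Metric.ball_subset_ball' ?_
  linarith [h p hp]

lemma card_mul_sq_le_of_annulus {δ a b : ℝ} (hδ : 0 < δ) (ha : δ / 2 ≤ a) (hab : a ≤ b)
    (hδb : b + δ / 2 ≤ 1 / 2) (S : Finset T2)
    (hS : ∀ p ∈ S, ∀ q ∈ S, p ≠ q → δ ≤ dist p q) (ξ : T2)
    (h : ∀ p ∈ S, a ≤ dist p ξ ∧ dist p ξ < b) :
    S.card * δ ^ 2 ≤ 4 * (b + δ / 2) ^ 2 - 4 * (a - δ / 2) ^ 2 := by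
  rw [← volume_real_ball (ξ := ξ) (r := b + δ / 2) (by linarith) hδb,
    ← volume_real_ball (ξ := ξ) (r := a - δ / 2) (by linarith) (by linarith),
    ← measureReal_sdiff (Metric.ball_subset_ball (by linarith)) Metric.isOpen_ball.measurableSet]
  refine card_mul_sq_le_volume hδ (by linarith) S hS fun p hp x hx => ?_
  obtain ⟨h1, h2⟩ := h p hp
  rw [Metric.mem_ball] at hx
  simp only [Set.mem_sdiff, Metric.mem_ball, not_lt]
  have h3 := dist_triangle x p ξ
  have h4 := dist_triangle p x ξ
  rw [dist_comm p x] at h4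
  constructor <;> linarith

/-- The relative density of a finite set in a ball of radius `R / L`. -/
def relDensity (W : Finset T2) (L R : ℝ) (ξ : T2) : ℝ :=
  ((W : Set T2) ∩ Metric.ball ξ (R / L)).ncard /
    ((kL L : ℝ) * (volume (Metric.ball ξ (R / L))).toReal)

lemma ncard_inter_ball (W : Finset T2) (ξ : T2) (s : ℝ) [DecidablePred fun w => dist w ξ < s] :
    ((W : Set T2) ∩ Metric.ball ξ s).ncard = (W.filter fun w => dist w ξ < s).card := by
  rw [← Set.ncard_coe_finset]
  congr 1
  ext w
  simp

lemma relDensity_nonneg (W : Finset T2) (L R : ℝ) (ξ : T2) : 0 ≤ relDensity W L R ξ := by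
  unfold relDensity
  positivity

lemma le_kL_mul_volume_ball {L R : ℝ} (hL : 0 < L) (hR : 0 ≤ R) (hRL : 2 * R ≤ L) (ξ : T2) :
    R ^ 2 / 20 ≤ (kL L : ℝ) * (volume (Metric.ball ξ (R / L))).toReal := by
  have h1 : R / L ≤ 1 / 2 := by
    rw [div_le_iff₀ hL]
    linarith
  rw [← measureReal_def, volume_real_ball (by positivity) h1]
  have h2 := sq_le_mul_kL L hL.le
  calc R ^ 2 / 20 = L ^ 2 * (R ^ 2 / (20 * L ^ 2)) := by field_simp
    _ ≤ (80 * kL L) * (R ^ 2 / (20 * L ^ 2)) := by gcongr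
    _ = _ := by
      field_simp
      ring

lemma relDensity_le {ε L R : ℝ} (hε : 0 < ε) (hε1 : ε ≤ 1) (hR : 1 ≤ R)
    (hRL : 2 * (R + 1) ≤ L) (W : Finset T2)
    (hsep : ∀ p ∈ W, ∀ q ∈ W, p ≠ q → ε / L ≤ dist p q) (ξ : T2) :
    relDensity W L R ξ ≤ 320 / ε ^ 2 := by
  classical
  have hL : 0 < L := by linarith
  have hv := le_kL_mul_volume_ball hL (by linarith) (by linarith) ξ (R := R)
  have hN := card_mul_sq_le_of_ball (δ := ε / L) (b := R / L) (by positivity) (by positivity)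
    (by
      rw [show R / L + ε / L / 2 = (R + ε / 2) / L by ring, div_le_iff₀ hL]
      linarith) (W.filter fun w => dist w ξ < R / L)
    (fun p hp q hq => hsep p (Finset.mem_filter.1 hp).1 q (Finset.mem_filter.1 hq).1) ξ
    fun p hp => (Finset.mem_filter.1 hp).2
  unfold relDensity
  rw [ncard_inter_ball]
  set N : ℝ := ((W.filter fun w => dist w ξ < R / L).card : ℝ)
  have hN' : N * ε ^ 2 ≤ 16 * R ^ 2 := by
    have h1 : N * ε ^ 2 ≤ 4 * (R + ε / 2) ^ 2 := by
      have h2 := mul_le_mul_of_nonneg_right hN (sq_nonneg L)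
      have e1 : N * (ε / L) ^ 2 * L ^ 2 = N * ε ^ 2 := by field_simp
      have e2 : 4 * (R / L + ε / L / 2) ^ 2 * L ^ 2 = 4 * (R + ε / 2) ^ 2 := by field_simp
      rwa [e1, e2] at h2
    nlinarith
  rw [div_le_div_iff₀ (lt_of_lt_of_le (by positivity) hv) (by positivity)]
  linarith

lemma le_relDensity {ε L R r σ C D : ℝ} (hε : 0 < ε) (hε1 : ε ≤ 1) (hr : 1 ≤ r) (hRr : R = r ^ 2)
    (hRL : 2 * (R + 2 * r + 1) ≤ L) (hσ : 0 < σ) (hσr : σ ^ 2 = 3840 / r) (W : Finset T2)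
    (hC : 0 < C) (hD : 0 < D)
    (hsep : ∀ p ∈ W, ∀ q ∈ W, p ≠ q → ε / L ≤ dist p q)
    (hup : ∀ a, ∑ w ∈ W, ‖trigPoly (freqs L) a w‖ ^ 2 ≤
      D * kL L * ∑ l ∈ freqs L, ‖a l‖ ^ 2)
    (hlow : ∀ a, (kL L : ℝ) * ∑ l ∈ freqs L, ‖a l‖ ^ 2 ≤
      C * ∑ w ∈ W, ‖trigPoly (freqs L) a w‖ ^ 2)
    (hσd : σ * ((C + D) / 2) ≤ 1) (ξ : T2) :
    (1 - σ * ((C + D) / 2) - 960 * ((1 + C ^ 2) / 2) / ε ^ 2 / r) / (1 + σ * ((1 + C ^ 2) / 2)) ≤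
      relDensity W L R ξ := by
  classical
  have hrR : r ≤ R := by nlinarith
  have hR0 : 0 < R := by linarith
  have hL : 1 ≤ L := by linarith
  have hL0 : 0 < L := by linarith
  have hk := kL_pos L
  have hσρ : 48 * L / (r / L) ≤ σ ^ 2 * kL L := by
    have h1 := sq_le_mul_kL L hL0.le
    rw [hσr]
    calc 48 * L / (r / L) = 48 / r * L ^ 2 := by field_simp
      _ ≤ 48 / r * (80 * kL L) := by gcongr
      _ = _ := by ring
  have hv := le_kL_mul_volume_ball hL0 (by linarith) (by linarith) ξ (R := R)
  set I := W.filter fun w => dist w ξ < R / L with hIdef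
  set A := (W \ I).filter fun w => dist w ξ < (R + 2 * r) / L with hAdef
  have hmain := local_density_inequality hL (ρ := r / L) (by positivity)
    (by rw [div_le_one hL0]; linarith) hσ hσρ W hC hD hup hlow
    (B := Metric.ball ξ ((R + r) / L)) Metric.isOpen_ball.measurableSet I A
    (Finset.filter_subset _ _) (Finset.filter_subset _ _)
    (fun w hw x hx => by
      have h1 := (Finset.mem_filter.1 hw).2
      rw [Metric.mem_ball, not_lt] at hx
      have h2 := dist_triangle x w ξ
      rw [add_div] at hx
      linarith)
    (fun w hw x hx => by
      have h1 : (R + 2 * r) / L ≤ dist w ξ := by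
        obtain ⟨h3, h4⟩ := Finset.mem_sdiff.1 hw
        by_contra h5
        exact h4 (Finset.mem_filter.2 ⟨h3, not_le.1 h5⟩)
      rw [Metric.mem_ball] at hx
      have h2 := dist_triangle w x ξ
      have h3 : (R + 2 * r) / L = (R + r) / L + r / L := by ring
      linarith)
  have hA := card_mul_sq_le_of_annulus (δ := ε / L) (a := R / L) (b := (R + 2 * r) / L)
    (by positivity)
    (by
      rw [div_div, div_le_div_iff₀ (by positivity) hL0]
      nlinarith)
    (by gcongr; linarith)
    (by
      rw [show (R + 2 * r) / L + ε / L / 2 = (R + 2 * r + ε / 2) / L by ring, div_le_iff₀ hL0]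
      linarith) A
    (fun p hp q hq => hsep p (Finset.mem_sdiff.1 (Finset.mem_filter.1 hp).1).1 q
      (Finset.mem_sdiff.1 (Finset.mem_filter.1 hq).1).1) ξ
    fun p hp => by
      obtain ⟨h1, h2⟩ := Finset.mem_filter.1 hp
      obtain ⟨h3, h4⟩ := Finset.mem_sdiff.1 h1
      refine ⟨?_, h2⟩
      by_contra h5
      exact h4 (Finset.mem_filter.2 ⟨h3, not_le.1 h5⟩)
  have hA' : (A.card : ℝ) * ε ^ 2 ≤ 48 * (r * R) := by
    have h1 : (A.card : ℝ) * ε ^ 2 ≤ 4 * (R + 2 * r + ε / 2) ^ 2 - 4 * (R - ε / 2) ^ 2 := by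
      have h2 := mul_le_mul_of_nonneg_right hA (sq_nonneg L)
      have e1 : (A.card : ℝ) * (ε / L) ^ 2 * L ^ 2 = A.card * ε ^ 2 := by field_simp
      have e2 : (4 * ((R + 2 * r) / L + ε / L / 2) ^ 2 - 4 * (R / L - ε / L / 2) ^ 2) * L ^ 2 =
          4 * (R + 2 * r + ε / 2) ^ 2 - 4 * (R - ε / 2) ^ 2 := by field_simp
      rwa [e1, e2] at h2
    have h3 : 4 * (R + 2 * r + ε / 2) ^ 2 - 4 * (R - ε / 2) ^ 2 = 8 * ((2 * r + ε) * (R + r)) := by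
      ring
    have h4 : (2 * r + ε) * (R + r) ≤ (3 * r) * (2 * R) := by
      gcongr <;> linarith
    linarith
  have hvol : volume.real (Metric.ball ξ (R / L)) ≤ volume.real (Metric.ball ξ ((R + r) / L)) :=
    measureReal_mono (Metric.ball_subset_ball (by gcongr; linarith))
  unfold relDensity
  rw [ncard_inter_ball, ← hIdef, ← measureReal_def]
  rw [← measureReal_def] at hv
  set v := volume.real (Metric.ball ξ (R / L))
  set v' := volume.real (Metric.ball ξ ((R + r) / L))
  set k : ℝ := (kL L : ℝ)
  set c := (1 + C ^ 2) / 2 with hc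
  set d := (C + D) / 2 with hd
  have hc0 : 0 < c := by
    rw [hc]
    positivity
  have hkv : 0 < k * v := lt_of_lt_of_le (by positivity) hv
  have h1 : k * v * (1 - σ * d) ≤ k * v' * (1 - σ * d) := by
    have : 0 ≤ 1 - σ * d := by linarith
    gcongr
  have h2 : k * v' * (1 - σ * d) ≤ I.card * (1 + σ * c) + A.card * c := by
    rw [show σ * (1 + C ^ 2) / 2 = σ * c by rw [hc]; ring,
      show σ * (C + D) / 2 = σ * d by rw [hd]; ring] at hmain
    linarith
  have h3 : A.card * c ≤ k * v * (960 * c / ε ^ 2 / r) := by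
    calc A.card * c = (A.card * ε ^ 2) * (c / ε ^ 2) := by field_simp
      _ ≤ 48 * (r * R) * (c / ε ^ 2) := by gcongr
      _ = R ^ 2 / 20 * (960 * c / ε ^ 2 / r) := by
        rw [hRr]
        field_simp
        norm_num
      _ ≤ _ := by gcongr
  rw [div_le_div_iff₀ (by positivity) hkv]
  linarith

/-! ### The lower density of a separated sampling family -/

lemma one_le_liminf_relDensity {ε C D : ℝ} (hε : 0 < ε) (hε1 : ε ≤ 1) (hC : 0 < C) (hD : 0 < D)
    (W : ℝ → Finset T2)
    (hsep : ∀ L, 1 ≤ L → ∀ p ∈ W L, ∀ q ∈ W L, p ≠ q → ε / L ≤ dist p q)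
    (hup : ∀ L, 1 ≤ L → ∀ a, ∑ w ∈ W L, ‖trigPoly (freqs L) a w‖ ^ 2 ≤
      D * kL L * ∑ l ∈ freqs L, ‖a l‖ ^ 2)
    (hlow : ∀ L, 1 ≤ L → ∀ a, (kL L : ℝ) * ∑ l ∈ freqs L, ‖a l‖ ^ 2 ≤
      C * ∑ w ∈ W L, ‖trigPoly (freqs L) a w‖ ^ 2) :
    1 ≤ liminf (fun R : ℝ => liminf (fun L : ℝ => ⨅ ξ : T2, relDensity (W L) L R ξ) atTop)
      atTop := by
  let σ : ℝ → ℝ := fun R => √(3840 / √R)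
  let F : ℝ → ℝ := fun R =>
    (1 - σ R * ((C + D) / 2) - 960 * ((1 + C ^ 2) / 2) / ε ^ 2 / √R) /
      (1 + σ R * ((1 + C ^ 2) / 2))
  have hσ0 : Tendsto σ atTop (nhds 0) := by
    have h1 : Tendsto (fun R : ℝ => 3840 / √R) atTop (nhds 0) :=
      tendsto_const_nhds.div_atTop Real.tendsto_sqrt_atTop
    have h2 := h1.sqrt
    rwa [Real.sqrt_zero] at h2
  have hF : Tendsto F atTop (nhds 1) := by
    have h1 : Tendsto (fun R : ℝ => 960 * ((1 + C ^ 2) / 2) / ε ^ 2 / √R) atTop (nhds 0) :=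
      tendsto_const_nhds.div_atTop Real.tendsto_sqrt_atTop
    have h2 := ((tendsto_const_nhds (x := (1 : ℝ))).sub (hσ0.mul_const ((C + D) / 2))).sub h1
    have h3 := (tendsto_const_nhds (x := (1 : ℝ))).add (hσ0.mul_const ((1 + C ^ 2) / 2))
    have h4 := h2.div h3 (by simp)
    simp only [zero_mul, sub_zero, add_zero, div_one] at h4
    exact h4
  have hσd : ∀ᶠ R in atTop, σ R * ((C + D) / 2) ≤ 1 := by
    have h1 := hσ0.mul_const ((C + D) / 2)
    rw [zero_mul] at h1
    exact h1.eventually_le_const one_pos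
  have hbdd : ∀ L R, BddBelow (Set.range fun ξ : T2 => relDensity (W L) L R ξ) := fun L R =>
    ⟨0, by
      rintro _ ⟨ξ, rfl⟩
      exact relDensity_nonneg _ _ _ _⟩
  have hinf_nonneg : ∀ L R, 0 ≤ ⨅ ξ : T2, relDensity (W L) L R ξ := fun L R =>
    le_ciInf fun ξ => relDensity_nonneg _ _ _ _
  have hinf_le : ∀ R, 1 ≤ R → ∀ᶠ L in atTop,
      ⨅ ξ : T2, relDensity (W L) L R ξ ≤ 320 / ε ^ 2 := by
    intro R hR
    filter_upwards [eventually_ge_atTop (2 * (R + 1)), eventually_ge_atTop 1] with L hL hL1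
    exact (ciInf_le (hbdd L R) 0).trans (relDensity_le hε hε1 hR hL _ (hsep L hL1) 0)
  have hcob : ∀ R, 1 ≤ R → IsCoboundedUnder (· ≥ ·) atTop
      fun L => ⨅ ξ : T2, relDensity (W L) L R ξ := fun R hR =>
    IsBoundedUnder.isCoboundedUnder_ge ⟨_, eventually_map.2 (hinf_le R hR)⟩
  have hlower : ∀ᶠ R in atTop, F R ≤
      liminf (fun L : ℝ => ⨅ ξ : T2, relDensity (W L) L R ξ) atTop := by
    filter_upwards [eventually_ge_atTop 1, hσd] with R hR hRσ
    refine le_liminf_of_le (hcob R hR) ?_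
    filter_upwards [eventually_ge_atTop (2 * (R + 2 * √R + 1)), eventually_ge_atTop 1] with L hL hL1
    have hr : 1 ≤ √R := Real.one_le_sqrt.2 hR
    refine le_ciInf fun ξ => ?_
    exact le_relDensity hε hε1 hr (Real.sq_sqrt (by linarith)).symm hL
      (Real.sqrt_pos.2 (by positivity)) (Real.sq_sqrt (by positivity)) (W L) hC hD (hsep L hL1)
      (hup L hL1) (hlow L hL1) hRσ ξ
  have hupper : ∀ᶠ R in atTop,
      liminf (fun L : ℝ => ⨅ ξ : T2, relDensity (W L) L R ξ) atTop ≤ 320 / ε ^ 2 := by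
    filter_upwards [eventually_ge_atTop 1] with R hR
    exact liminf_le_of_frequently_le (hinf_le R hR).frequently
      ⟨0, eventually_map.2 (Eventually.of_forall fun L => hinf_nonneg L R)⟩
  rw [← hF.liminf_eq]
  exact liminf_le_liminf hlower hF.isBoundedUnder_ge
    (IsBoundedUnder.isCoboundedUnder_ge ⟨_, eventually_map.2 hupper⟩)

/-- Enumeration of a finite set of points. -/
lemma exists_enumeration (W : Finset T2) : ∃ w : ℕ → T2, (∀ j < W.card, w j ∈ W) ∧
    (∀ j < W.card, ∀ i < W.card, j ≠ i → w j ≠ w i) ∧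
    (∀ g : T2 → ℝ, ∑ j ∈ Finset.range W.card, g (w j) = ∑ p ∈ W, g p) ∧
    {p | ∃ j < W.card, w j = p} = (W : Set T2) := by
  let e := W.equivFin.symm
  let w : ℕ → T2 := fun j => if h : j < W.card then e ⟨j, h⟩ else 0
  have hw : ∀ j (h : j < W.card), w j = e ⟨j, h⟩ := fun j h => dif_pos h
  refine ⟨w, fun j hj => ?_, fun j hj i hi hji hEq => ?_, fun g => ?_, ?_⟩
  · rw [hw j hj]
    exact (e ⟨j, hj⟩).2
  · rw [hw j hj, hw i hi] at hEq
    exact hji (Fin.mk.inj_iff.1 (e.injective (Subtype.ext hEq)))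
  · rw [Finset.sum_range, ← Finset.sum_coe_sort W, ← e.sum_comp]
    exact Finset.sum_congr rfl fun i _ => by rw [hw i i.2]
  · ext p
    constructor
    · rintro ⟨j, hj, rfl⟩
      rw [hw j hj]
      exact (e ⟨j, hj⟩).2
    · intro hp
      refine ⟨W.equivFin ⟨p, hp⟩, (W.equivFin ⟨p, hp⟩).2, ?_⟩
      rw [hw _ (W.equivFin ⟨p, hp⟩).2]
      simp [e]

/-- **Density theorem, Marcinkiewicz–Zygmund part, on the flat torus.**
If the triangular family `Z(L) = {z L 0, …, z L (m L − 1)}` (with `m L ≥ k_L`) is an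
`L²`-MZ family for the spaces `E_L`, then it contains a uniformly separated triangular
subfamily which is again an `L²`-MZ family and whose lower Beurling–Landau density is
at least `1`. -/
theorem stmt_14 (m : ℝ → ℕ) (z : ℝ → ℕ → T2)
    (hcard : ∀ L : ℝ, 1 ≤ L → kL L ≤ m L)
    (hMZ : ∃ C : ℝ, 0 < C ∧ ∀ L : ℝ, 1 ≤ L → ∀ f ∈ EL L,
      (C⁻¹ / (kL L : ℝ) * ∑ j ∈ Finset.range (m L), ‖f (z L j)‖ ^ 2 ≤
          ∫ p : T2, ‖f p‖ ^ 2) ∧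
      (∫ p : T2, ‖f p‖ ^ 2 ≤
          C / (kL L : ℝ) * ∑ j ∈ Finset.range (m L), ‖f (z L j)‖ ^ 2)) :
    ∃ (m' : ℝ → ℕ) (w : ℝ → ℕ → T2),
      -- Z̃(L) ⊆ Z(L)
      (∀ L : ℝ, 1 ≤ L → ∀ j < m' L, ∃ i < m L, w L j = z L i) ∧
      -- Z̃ is uniformly separated
      (∃ ε : ℝ, 0 < ε ∧ ∀ L : ℝ, 1 ≤ L → ∀ j < m' L, ∀ i < m' L, j ≠ i →
        ε / L ≤ dist (w L j) (w L i)) ∧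
      -- Z̃ is an L²-MZ family
      (∃ C : ℝ, 0 < C ∧ ∀ L : ℝ, 1 ≤ L → ∀ f ∈ EL L,
        (C⁻¹ / (kL L : ℝ) * ∑ j ∈ Finset.range (m' L), ‖f (w L j)‖ ^ 2 ≤
            ∫ p : T2, ‖f p‖ ^ 2) ∧
        (∫ p : T2, ‖f p‖ ^ 2 ≤
            C / (kL L : ℝ) * ∑ j ∈ Finset.range (m' L), ‖f (w L j)‖ ^ 2)) ∧
      -- and D⁻(Z̃) ≥ 1
      1 ≤ liminf (fun R : ℝ => liminf (fun L : ℝ =>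
            ⨅ ξ : T2,
              (({p | ∃ j < m' L, w L j = p} ∩ Metric.ball ξ (R / L)).ncard : ℝ) /
                ((kL L : ℝ) * (volume (Metric.ball ξ (R / L))).toReal)) atTop) atTop := by
  obtain ⟨C, hC, hMZ⟩ := hMZ
  set ε : ℝ := min (1 / 4) (1 / (20 * C)) with hεdef
  have hε : 0 < ε := lt_min (by norm_num) (by positivity)
  have hε4 : ε ≤ 1 / 4 := min_le_left _ _
  have hεC : 20 * C * ε ≤ 1 := by
    calc 20 * C * ε ≤ 20 * C * (1 / (20 * C)) := by
          gcongr
          exact min_le_right _ _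
      _ = 1 := by field_simp
  have hex : ∀ L : ℝ, ∃ W : Finset T2, 1 ≤ L → (∀ w ∈ W, ∃ j ∈ Finset.range (m L), w = z L j) ∧
      (∀ p ∈ W, ∀ q ∈ W, p ≠ q → ε / L ≤ dist p q) ∧
      (∀ a, ∑ w ∈ W, ‖trigPoly (freqs L) a w‖ ^ 2 ≤ C * kL L * ∑ l ∈ freqs L, ‖a l‖ ^ 2) ∧
      ∀ a, (kL L : ℝ) * ∑ l ∈ freqs L, ‖a l‖ ^ 2 ≤
        16 * C ^ 2 * ∑ w ∈ W, ‖trigPoly (freqs L) a w‖ ^ 2 := by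
    intro L
    by_cases hL : 1 ≤ L
    · have hk := kL_pos L
      obtain ⟨W, hW⟩ := exists_separated_subfamily (lt_of_lt_of_le one_pos hL)
        (Finset.range (m L)) (z L) hC hε hε4 hεC
        (fun a => by
          have h1 := (hMZ L hL _ (mem_EL_iff.2 ⟨a, rfl⟩)).1
          rw [integral_norm_sq_trigPoly, div_mul_eq_mul_div, inv_mul_eq_div, div_div,
            div_le_iff₀ (by positivity)] at h1
          linarith)
        (fun a => by
          have h1 := (hMZ L hL _ (mem_EL_iff.2 ⟨a, rfl⟩)).2
          rw [integral_norm_sq_trigPoly, div_mul_eq_mul_div, le_div_iff₀ hk] at h1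
          linarith)
      exact ⟨W, fun _ => hW⟩
    · exact ⟨∅, fun h => absurd h hL⟩
  choose W hW using hex
  choose w hwmem hwinj hwsum hwset using fun L => exists_enumeration (W L)
  refine ⟨fun L => (W L).card, w, fun L hL j hj => ?_, ⟨ε, hε, fun L hL j hj i hi hji => ?_⟩,
    ⟨max C (16 * C ^ 2), lt_max_of_lt_left hC, fun L hL f hf => ?_⟩, ?_⟩
  · obtain ⟨i, hi, h⟩ := (hW L hL).1 _ (hwmem L j hj)
    exact ⟨i, Finset.mem_range.1 hi, h⟩
  · exact (hW L hL).2.1 _ (hwmem L j hj) _ (hwmem L i hi) (hwinj L j hj i hi hji)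
  · obtain ⟨a, rfl⟩ := mem_EL_iff.1 hf
    obtain ⟨-, -, hup, hlow⟩ := hW L hL
    have hk := kL_pos L
    have hS : 0 ≤ ∑ p ∈ W L, ‖trigPoly (freqs L) a p‖ ^ 2 :=
      Finset.sum_nonneg fun _ _ => sq_nonneg _
    have hA : 0 ≤ ∑ l ∈ freqs L, ‖a l‖ ^ 2 := Finset.sum_nonneg fun _ _ => sq_nonneg _
    have hM : 0 < max C (16 * C ^ 2) := lt_max_of_lt_left hC
    rw [hwsum L fun p => ‖trigPoly (freqs L) a p‖ ^ 2, integral_norm_sq_trigPoly]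
    constructor
    · rw [div_mul_eq_mul_div, inv_mul_eq_div, div_div, div_le_iff₀ (by positivity)]
      calc _ ≤ C * kL L * ∑ l ∈ freqs L, ‖a l‖ ^ 2 := hup a
        _ ≤ max C (16 * C ^ 2) * kL L * ∑ l ∈ freqs L, ‖a l‖ ^ 2 := by
          gcongr
          exact le_max_left _ _
        _ = _ := by ring
    · rw [div_mul_eq_mul_div, le_div_iff₀ hk, mul_comm]
      refine (hlow a).trans ?_
      gcongr
      exact le_max_right _ _
  · simp_rw [hwset]
    exact one_le_liminf_relDensity hε (hε4.trans (by norm_num)) (C := 16 * C ^ 2) (D := C)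
      (by positivity) hC W (fun L hL => (hW L hL).2.1) (fun L hL => (hW L hL).2.2.1)
      fun L hL => (hW L hL).2.2.2

end
end
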